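/- arXiv:2506.13194 — 9 statements merged into one kernel-verified Lean document; each statement's English description precedes it below -/
import Mathlib

section
/- Contact term relation (1): for all a, b, c ∈ A one has B(a, B(b, c)) = B(b, B(a, c)). -/
open scoped BigOperators

/-- Extension of an `ℕ`-indexed grading to `ℤ`, with zero components in negative degrees. -/
def gradeZ {V : Type*} [AddCommGroup V] [Module ℂ V]
    (Vgr : ℕ → Submodule ℂ V) (n : ℤ) : Submodule ℂ V :=
  if 0 ≤ n then Vgr n.toNat else ⊥

/-- Contact term relation (1): `B(a, B(b, c)) = B(b, B(a, c))`. -/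
theorem contact_term_relation_one
    {V : Type*} [AddCommGroup V] [Module ℂ V]
    (Vgr : ℕ → Submodule ℂ V)
    (hinternal : DirectSum.IsInternal Vgr)
    (T : V →ₗ[ℂ] V)
    (hTgrade : ∀ (n : ℕ), ∀ x ∈ Vgr n, T x ∈ Vgr (n + 1))
    (p : ℤ → V →ₗ[ℂ] V →ₗ[ℂ] V)
    (hgrade : ∀ (m k : ℕ) (n : ℤ), ∀ a ∈ Vgr m, ∀ b ∈ Vgr k,
      p n a b ∈ gradeZ Vgr ((m : ℤ) + (k : ℤ) - n - 1))
    (hfin : ∀ a b : V, ∃ N : ℤ, ∀ n : ℤ, N ≤ n → p n a b = 0)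
    (htrans1 : ∀ (n : ℤ) (a b : V), p n (T a) b = (-(n : ℂ)) • p (n - 1) a b)
    (htrans2 : ∀ (n : ℤ) (a b : V),
      T (p n a b) + (n : ℂ) • p (n - 1) a b = p n a (T b))
    (hskew : ∀ (n : ℤ) (a b : V),
      p n a b = ∑ᶠ k : ℕ, ((-1 : ℂ) ^ ((k : ℤ) + n + 1) / (Nat.factorial k : ℂ)) •
        ((T ^ k) (p (n + (k : ℤ)) b a)))
    (hcomm : ∀ (m n : ℕ) (a b c : V),
      p (m : ℤ) a (p (n : ℤ) b c) - p (n : ℤ) b (p (m : ℤ) a c) =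
        ∑ᶠ k : ℕ, (Nat.choose m k : ℂ) • p ((m : ℤ) + (n : ℤ) - (k : ℤ)) (p (k : ℤ) a b) c)
    (hker : ∀ x : V, T x = 0 → x ∈ Vgr 0)
    (A : Submodule ℂ V)
    (hAgraded : A = ⨆ n : ℕ, (A ⊓ Vgr n))
    (hTA : ∀ a ∈ A, T a ∈ A)
    (hclosed : ∀ (n : ℤ), ∀ a ∈ A, ∀ b ∈ A, p n a b ∈ A)
    (hA1 : A ⊓ Vgr 1 = ⊥)
    (hDijk : ∀ a ∈ A, ∀ b ∈ A, p 0 a b ∈ A.map T)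
    (B : V → V → V)
    (hB : ∀ a ∈ A, ∀ b ∈ A,
      B a b ∈ A ⊓ (⨆ (n : ℕ) (_ : 1 ≤ n), Vgr n) ∧ T (B a b) = p 0 a b) :
    ∀ a ∈ A, ∀ b ∈ A, ∀ c ∈ A, B a (B b c) = B b (B a c) := by
  have hdisj : ∀ x, x ∈ Vgr 0 → x ∈ (⨆ (n : ℕ) (_ : 1 ≤ n), Vgr n) → x = 0 := by
    intro x hx hx'
    refine Submodule.disjoint_def.mp (hinternal.submodule_iSupIndep 0) x hx ?_
    exact (iSup₂_mono' fun n hn => ⟨n, by omega, le_rfl⟩ :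
      (⨆ (n : ℕ) (_ : 1 ≤ n), Vgr n) ≤ ⨆ (n : ℕ) (_ : n ≠ 0), Vgr n) hx'
  have hTpos : ∀ x ∈ (⨆ (n : ℕ) (_ : 1 ≤ n), Vgr n),
      T x ∈ (⨆ (n : ℕ) (_ : 1 ≤ n), Vgr n) := by
    have hle : (⨆ (n : ℕ) (_ : 1 ≤ n), Vgr n) ≤
        (⨆ (n : ℕ) (_ : 1 ≤ n), Vgr n).comap T := by
      refine iSup₂_le fun n hn x hx => ?_
      exact le_iSup₂_of_le (f := fun (n : ℕ) (_ : 1 ≤ n) => Vgr n) (n + 1) (by omega) le_rfl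
        (hTgrade n x hx)
    exact hle
  have hT0 : ∀ x y, T (p 0 x y) = p 0 x (T y) := fun x y => by
    simpa using htrans2 0 x y
  intro a ha b hb c hc
  obtain ⟨hab, hTab⟩ := hB a ha b hb
  obtain ⟨hbc, hTbc⟩ := hB b hb c hc
  obtain ⟨hac, hTac⟩ := hB a ha c hc
  obtain ⟨habc, hTabc⟩ := hB a ha _ hbc.1
  obtain ⟨hbac, hTbac⟩ := hB b hb _ hac.1
  have hbracket : p 0 a (p 0 b c) - p 0 b (p 0 a c) = 0 := by
    have h := hcomm 0 0 a b c
    rw [finsum_eq_single _ 0 fun k hk => by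
      simp [Nat.choose_eq_zero_of_lt (Nat.pos_of_ne_zero hk)]] at h
    have h' : p 0 (p 0 a b) c = 0 := by
      rw [← hTab]
      simpa using htrans1 0 (B a b) c
    simpa [h'] using h
  have hD := sub_mem habc.2 hbac.2
  have hTT : T (T (B a (B b c) - B b (B a c))) = 0 := by
    rw [map_sub, map_sub, hTabc, hTbac, hT0, hT0, hTbc, hTac, hbracket]
  have hT : T (B a (B b c) - B b (B a c)) = 0 := hdisj _ (hker _ hTT) (hTpos _ hD)
  exact sub_eq_zero.mp (hdisj _ (hker _ hT) hD)
end

section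
/- Contact term relation (2): for all a, b, c ∈ A one has C(a, B(b, c)) − B(b, C(a, c)) + B(a, B(b, c)) = B(C(a, b), c). -/
open scoped BigOperators

/-- In an internally `ℕ`-graded module, degree zero meets the sum of positive degrees trivially. -/
theorem disjoint_positive_degrees {V : Type*} [AddCommGroup V] [Module ℂ V]
    (Vgr : ℕ → Submodule ℂ V) (hinternal : DirectSum.IsInternal Vgr) :
    Disjoint (Vgr 0) (⨆ (n : ℕ) (_ : 1 ≤ n), Vgr n) :=
  (hinternal.submodule_iSupIndep 0).mono_right <|
    iSup₂_le fun n hn => le_iSup₂_of_le n (Nat.one_le_iff_ne_zero.1 hn) le_rfl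

/-- A linear map of degree one takes values in the sum of positive degrees. -/
theorem map_mem_positive_degrees {V : Type*} [AddCommGroup V] [Module ℂ V]
    (Vgr : ℕ → Submodule ℂ V) (hinternal : DirectSum.IsInternal Vgr) (T : V →ₗ[ℂ] V)
    (hT : ∀ (n : ℕ), ∀ x ∈ Vgr n, T x ∈ Vgr (n + 1)) (x : V) :
    T x ∈ ⨆ (n : ℕ) (_ : 1 ≤ n), Vgr n := by
  suffices (⊤ : Submodule ℂ V) ≤ (⨆ (n : ℕ) (_ : 1 ≤ n), Vgr n).comap T from
    this Submodule.mem_top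
  rw [← hinternal.submodule_iSup_eq_top]
  exact iSup_le fun n y hy =>
    (le_iSup₂_of_le (n + 1) n.succ_pos le_rfl : Vgr (n + 1) ≤ _) (hT n y hy)

/-- Contact term relation (2):
`C(a, B(b, c)) − B(b, C(a, c)) + B(a, B(b, c)) = B(C(a, b), c)`. -/
theorem contact_term_relation_two
    {V : Type*} [AddCommGroup V] [Module ℂ V]
    (Vgr : ℕ → Submodule ℂ V)
    (hinternal : DirectSum.IsInternal Vgr)
    (T : V →ₗ[ℂ] V)
    (hTgrade : ∀ (n : ℕ), ∀ x ∈ Vgr n, T x ∈ Vgr (n + 1))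
    (p : ℤ → V →ₗ[ℂ] V →ₗ[ℂ] V)
    (hgrade : ∀ (m k : ℕ) (n : ℤ), ∀ a ∈ Vgr m, ∀ b ∈ Vgr k,
      p n a b ∈ gradeZ Vgr ((m : ℤ) + (k : ℤ) - n - 1))
    (hfin : ∀ a b : V, ∃ N : ℤ, ∀ n : ℤ, N ≤ n → p n a b = 0)
    (htrans1 : ∀ (n : ℤ) (a b : V), p n (T a) b = (-(n : ℂ)) • p (n - 1) a b)
    (htrans2 : ∀ (n : ℤ) (a b : V),
      T (p n a b) + (n : ℂ) • p (n - 1) a b = p n a (T b))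
    (hskew : ∀ (n : ℤ) (a b : V),
      p n a b = ∑ᶠ k : ℕ, ((-1 : ℂ) ^ ((k : ℤ) + n + 1) / (Nat.factorial k : ℂ)) •
        ((T ^ k) (p (n + (k : ℤ)) b a)))
    (hcomm : ∀ (m n : ℕ) (a b c : V),
      p (m : ℤ) a (p (n : ℤ) b c) - p (n : ℤ) b (p (m : ℤ) a c) =
        ∑ᶠ k : ℕ, (Nat.choose m k : ℂ) • p ((m : ℤ) + (n : ℤ) - (k : ℤ)) (p (k : ℤ) a b) c)
    (hker : ∀ x : V, T x = 0 → x ∈ Vgr 0)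
    (A : Submodule ℂ V)
    (hAgraded : A = ⨆ n : ℕ, (A ⊓ Vgr n))
    (hTA : ∀ a ∈ A, T a ∈ A)
    (hclosed : ∀ (n : ℤ), ∀ a ∈ A, ∀ b ∈ A, p n a b ∈ A)
    (hA1 : A ⊓ Vgr 1 = ⊥)
    (hDijk : ∀ a ∈ A, ∀ b ∈ A, p 0 a b ∈ A.map T)
    (B : V → V → V)
    (hB : ∀ a ∈ A, ∀ b ∈ A,
      B a b ∈ A ⊓ (⨆ (n : ℕ) (_ : 1 ≤ n), Vgr n) ∧ T (B a b) = p 0 a b)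
    (C : V → V → V)
    (hC : ∀ a b : V, C a b = p 1 a b - B a b) :
    ∀ a ∈ A, ∀ b ∈ A, ∀ c ∈ A,
      C a (B b c) - B b (C a c) + B a (B b c) = B (C a b) c := by
  intro a ha b hb c hc
  set P : Submodule ℂ V := ⨆ (n : ℕ) (_ : 1 ≤ n), Vgr n with hP
  have hVP : ∀ n : ℕ, 1 ≤ n → Vgr n ≤ P := fun n hn => le_iSup₂_of_le n hn le_rfl
  have hBA : ∀ x ∈ A, ∀ y ∈ A, B x y ∈ A := fun x hx y hy => (hB x hx y hy).1.1
  have hBP : ∀ x ∈ A, ∀ y ∈ A, B x y ∈ P := fun x hx y hy => (hB x hx y hy).1.2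
  have hTB : ∀ x ∈ A, ∀ y ∈ A, T (B x y) = p 0 x y := fun x hx y hy => (hB x hx y hy).2
  have hCA : ∀ x ∈ A, ∀ y ∈ A, C x y ∈ A := fun x hx y hy => by
    rw [hC]; exact A.sub_mem (hclosed 1 x hx y hy) (hBA x hx y hy)
  have hinj : ∀ x ∈ P, T x = 0 → x = 0 := fun x hx h0 =>
    Submodule.disjoint_def.1 (disjoint_positive_degrees Vgr hinternal) x (hker x h0) hx
  have hTP : ∀ x, T x ∈ P := fun x =>
    map_mem_positive_degrees Vgr hinternal T hTgrade x
  have h0P : ∀ x ∈ A, ∀ y ∈ A, p 0 x y ∈ P := fun x hx y hy => hTB x hx y hy ▸ hTP _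
  have h1P : ∀ x ∈ A, ∀ y ∈ P, p 1 x y ∈ P := by
    intro x hx y hy
    rw [hAgraded] at hx
    induction hx using Submodule.iSup_induction' with
    | zero => simp
    | add u v _ _ hu hv => rw [map_add, LinearMap.add_apply]; exact P.add_mem hu hv
    | mem m u hu =>
      suffices P ≤ P.comap (p 1 u) from this hy
      refine iSup₂_le fun k hk z hz => ?_
      change p 1 u z ∈ P
      match m, hu with
      | 0, hu =>
        have hTu : T u = 0 := by
          have : T u ∈ A ⊓ Vgr 1 := ⟨hTA u hu.1, hTgrade 0 u hu.2⟩
          rwa [hA1, Submodule.mem_bot] at this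
        have h := htrans1 2 u z
        rw [hTu, map_zero, LinearMap.zero_apply] at h
        have h' : p 1 u z = 0 := by simpa using h
        rw [h']
        exact P.zero_mem
      | 1, hu =>
        rw [hA1, Submodule.mem_bot] at hu
        simp [hu]
      | m + 2, hu =>
        have h := hgrade (m + 2) k 1 u hu.2 z hz
        have hdeg : ((m + 2 : ℕ) : ℤ) + (k : ℤ) - 1 - 1 = ((m + k : ℕ) : ℤ) := by
          push_cast; ring
        rw [hdeg, gradeZ, if_pos (Int.natCast_nonneg _), Int.toNat_natCast] at h
        exact hVP (m + k) (by omega) h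
  have hT0 : ∀ x y : V, p 0 (T x) y = 0 := fun x y => by
    have h := htrans1 0 x y
    simpa using h
  have hT1 : ∀ x y : V, p 1 (T x) y = -p 0 x y := fun x y => by
    have h := htrans1 1 x y
    simpa using h
  have h0T : ∀ x y : V, p 0 x (T y) = T (p 0 x y) := fun x y => by
    have h := htrans2 0 x y
    simpa using h.symm
  have h1T : ∀ x y : V, p 1 x (T y) = T (p 1 x y) + p 0 x y := fun x y => by
    have h := htrans2 1 x y
    simpa using h.symm
  have hcomm00 : ∀ x y z : V, p 0 x (p 0 y z) - p 0 y (p 0 x z) = p 0 (p 0 x y) z := by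
    intro x y z
    have h := hcomm 0 0 x y z
    rw [finsum_eq_single _ 0 fun k hk => by
      rw [Nat.choose_eq_zero_of_lt (Nat.pos_of_ne_zero hk), Nat.cast_zero, zero_smul]] at h
    simpa using h
  have hcomm10 : ∀ x y z : V, p 1 x (p 0 y z) - p 0 y (p 1 x z) =
      p 1 (p 0 x y) z + p 0 (p 1 x y) z := by
    intro x y z
    have h := hcomm 1 0 x y z
    rw [finsum_eq_sum_of_support_subset (s := Finset.range 2) _ (by
      intro k hk
      by_contra hk'
      refine hk ?_
      have hlt : 1 < k := by simpa using hk'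
      simp only [Nat.choose_eq_zero_of_lt hlt, Nat.cast_zero, zero_smul])] at h
    simpa [Finset.sum_range_succ] using h
  have hswap : p 0 a (B b c) = p 0 b (B a c) := by
    rw [← sub_eq_zero]
    refine hinj _ (P.sub_mem (h0P a ha _ (hBA b hb c hc)) (h0P b hb _ (hBA a ha c hc))) ?_
    rw [map_sub, ← h0T, ← h0T, hTB b hb c hc, hTB a ha c hc, hcomm00, ← hTB a ha b hb, hT0]
  rw [← sub_eq_zero, hC a (B b c), sub_right_comm, sub_add_cancel]
  refine hinj _ (P.sub_mem (P.sub_mem (h1P a ha _ (hBP b hb c hc))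
    (hBP b hb _ (hCA a ha c hc))) (hBP _ (hCA a ha b hb) c hc)) ?_
  have h1 := h1T a (B b c)
  have h2 := hcomm10 a b c
  rw [hTB b hb c hc] at h1
  rw [← hTB a ha b hb, hT1] at h2
  rw [map_sub, map_sub, hTB b hb _ (hCA a ha c hc), hTB _ (hCA a ha b hb) c hc, hC a c, hC a b,
    map_sub, map_sub, LinearMap.sub_apply, ← hswap, eq_sub_of_add_eq h1.symm]
  rw [sub_eq_iff_eq_add] at h2
  rw [h2]
  abel
end

section
/- Contact term relation (3): for all a, b, c ∈ A, the element (C(a, C(b, c)) − C(b, C(a, c))) − (C(C(a, b), c) − C(C(b, a), c)) lies in T(A), i.e. [C_{i→k}, C_{j→k}] ≡ C_{j→k}C_{i→j} − C_{i→k}C_{j→i} modulo the image of T. -/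
open scoped BigOperators

/-- Contact term relation (3): the element
`(C(a, C(b, c)) − C(b, C(a, c))) − (C(C(a, b), c) − C(C(b, a), c))` lies in `T(A)`. -/
theorem contact_term_relation_three
    {V : Type*} [AddCommGroup V] [Module ℂ V]
    (Vgr : ℕ → Submodule ℂ V)
    (hinternal : DirectSum.IsInternal Vgr)
    (T : V →ₗ[ℂ] V)
    (hTgrade : ∀ (n : ℕ), ∀ x ∈ Vgr n, T x ∈ Vgr (n + 1))
    (p : ℤ → V →ₗ[ℂ] V →ₗ[ℂ] V)
    (hgrade : ∀ (m k : ℕ) (n : ℤ), ∀ a ∈ Vgr m, ∀ b ∈ Vgr k,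
      p n a b ∈ gradeZ Vgr ((m : ℤ) + (k : ℤ) - n - 1))
    (hfin : ∀ a b : V, ∃ N : ℤ, ∀ n : ℤ, N ≤ n → p n a b = 0)
    (htrans1 : ∀ (n : ℤ) (a b : V), p n (T a) b = (-(n : ℂ)) • p (n - 1) a b)
    (htrans2 : ∀ (n : ℤ) (a b : V),
      T (p n a b) + (n : ℂ) • p (n - 1) a b = p n a (T b))
    (hskew : ∀ (n : ℤ) (a b : V),
      p n a b = ∑ᶠ k : ℕ, ((-1 : ℂ) ^ ((k : ℤ) + n + 1) / (Nat.factorial k : ℂ)) •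
        ((T ^ k) (p (n + (k : ℤ)) b a)))
    (hcomm : ∀ (m n : ℕ) (a b c : V),
      p (m : ℤ) a (p (n : ℤ) b c) - p (n : ℤ) b (p (m : ℤ) a c) =
        ∑ᶠ k : ℕ, (Nat.choose m k : ℂ) • p ((m : ℤ) + (n : ℤ) - (k : ℤ)) (p (k : ℤ) a b) c)
    (hker : ∀ x : V, T x = 0 → x ∈ Vgr 0)
    (A : Submodule ℂ V)
    (hAgraded : A = ⨆ n : ℕ, (A ⊓ Vgr n))
    (hTA : ∀ a ∈ A, T a ∈ A)
    (hclosed : ∀ (n : ℤ), ∀ a ∈ A, ∀ b ∈ A, p n a b ∈ A)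
    (hA1 : A ⊓ Vgr 1 = ⊥)
    (hDijk : ∀ a ∈ A, ∀ b ∈ A, p 0 a b ∈ A.map T)
    (B : V → V → V)
    (hB : ∀ a ∈ A, ∀ b ∈ A,
      B a b ∈ A ⊓ (⨆ (n : ℕ) (_ : 1 ≤ n), Vgr n) ∧ T (B a b) = p 0 a b)
    (C : V → V → V)
    (hC : ∀ a b : V, C a b = p 1 a b - B a b) :
    ∀ a ∈ A, ∀ b ∈ A, ∀ c ∈ A,
      (C a (C b c) - C b (C a c)) - (C (C a b) c - C (C b a) c) ∈ A.map T := by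
  classical
  set P : Submodule ℂ V := ⨆ (n : ℕ) (_ : 1 ≤ n), Vgr n with hP
  have hVP : ∀ n : ℕ, 1 ≤ n → ∀ x ∈ Vgr n, x ∈ P := fun n hn x hx =>
    (le_iSup₂_of_le (f := fun (n : ℕ) (_ : 1 ≤ n) => Vgr n) n hn le_rfl) hx
  have hdisj : Disjoint (Vgr 0) P := by
    refine (hinternal.submodule_iSupIndep 0).mono_right ?_
    exact iSup₂_le fun n hn => le_iSup₂_of_le (f := fun (n : ℕ) (_ : n ≠ 0) => Vgr n) n
      (by omega) le_rfl
  have hinj : ∀ x ∈ P, ∀ y ∈ P, T x = T y → x = y := by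
    intro x hx y hy h
    have h0 : x - y ∈ Vgr 0 := hker _ (by rw [map_sub, h, sub_self])
    exact sub_eq_zero.mp (Submodule.disjoint_def.mp hdisj _ h0 (P.sub_mem hx hy))
  have hzero : ∀ a ∈ A ⊓ Vgr 0, ∀ (n : ℤ) (b : V), n ≠ -1 → p n a b = 0 := by
    rintro a ⟨haA, ha⟩ n b hn
    have hT : T a = 0 := by
      have h : T a ∈ A ⊓ Vgr 1 := ⟨hTA a haA, hTgrade 0 a ha⟩
      rwa [hA1, Submodule.mem_bot] at h
    have h := htrans1 (n + 1) a b
    rw [hT, map_zero, LinearMap.zero_apply, add_sub_cancel_right] at h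
    have hn' : (-((n + 1 : ℤ) : ℂ)) ≠ 0 := by
      rw [neg_ne_zero, Int.cast_ne_zero]; omega
    exact (smul_eq_zero.mp h.symm).resolve_left hn'
  have hone_hom : ∀ (m k : ℕ), ∀ a ∈ A ⊓ Vgr m, ∀ b ∈ A ⊓ Vgr k, p 1 a b ∈ P := by
    intro m k a ha b hb
    obtain rfl | hm := eq_or_ne m 0
    · rw [hzero a ha 1 b (by omega)]; exact P.zero_mem
    obtain rfl | hk := eq_or_ne k 0
    · rw [hskew]
      have : ∀ k : ℕ, p (1 + (k : ℤ)) b a = 0 := fun k => hzero b hb _ a (by omega)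
      simp [this]
    obtain rfl | hm1 := eq_or_ne m 1
    · rw [hA1, Submodule.mem_bot] at ha; simp [ha]
    obtain rfl | hk1 := eq_or_ne k 1
    · rw [hA1, Submodule.mem_bot] at hb; simp [hb]
    have h := hgrade m k 1 a ha.2 b hb.2
    rw [gradeZ, if_pos (by omega)] at h
    exact hVP _ (by omega) _ h
  have hone : ∀ a ∈ A, ∀ b ∈ A, p 1 a b ∈ P := by
    intro a ha b hb
    rw [hAgraded] at ha hb
    induction ha using Submodule.iSup_induction' with
    | zero => simp
    | add x y _ _ hx hy => simpa using P.add_mem hx hy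
    | mem m a ha =>
      induction hb using Submodule.iSup_induction' with
      | zero => simp
      | add x y _ _ hx hy => simpa using P.add_mem hx hy
      | mem k b hb => exact hone_hom m k a ha b hb
  have hBA : ∀ a ∈ A, ∀ b ∈ A, B a b ∈ A := fun a ha b hb => (hB a ha b hb).1.1
  have hBP : ∀ a ∈ A, ∀ b ∈ A, B a b ∈ P := fun a ha b hb => (hB a ha b hb).1.2
  have hBT : ∀ a ∈ A, ∀ b ∈ A, T (B a b) = p 0 a b := fun a ha b hb => (hB a ha b hb).2
  have hCA : ∀ a ∈ A, ∀ b ∈ A, C a b ∈ A := fun a ha b hb => by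
    rw [hC]; exact A.sub_mem (hclosed 1 a ha b hb) (hBA a ha b hb)
  have hTP : ∀ x, T x ∈ P := by
    intro x
    have : ⊤ ≤ P.comap T := hinternal.submodule_iSup_eq_top ▸
      iSup_le fun n x hx => hVP (n + 1) (by omega) _ (hTgrade n x hx)
    exact this Submodule.mem_top
  have hcomm0 : ∀ (n : ℕ) (a b c : V),
      p 0 a (p n b c) - p n b (p 0 a c) = p n (p 0 a b) c := by
    intro n a b c
    have h := hcomm 0 n a b c
    rw [finsum_eq_single _ 0 (fun k hk => by
      rw [Nat.choose_eq_zero_of_lt (by omega)]; simp)] at h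
    simpa using h
  have hcomm1 : ∀ (n : ℕ) (a b c : V),
      p 1 a (p n b c) - p n b (p 1 a c) = p (1 + n) (p 0 a b) c + p n (p 1 a b) c := by
    intro n a b c
    have h := hcomm 1 n a b c
    rw [finsum_eq_sum_of_support_subset (s := Finset.range 2) _ (by
      intro k hk
      by_contra hk'
      simp only [Finset.coe_range, Set.mem_Iio, not_lt] at hk'
      apply hk
      simp [Nat.choose_eq_zero_of_lt (show 1 < k by omega)])] at h
    simpa [Finset.sum_range_succ] using h
  have htr0 : ∀ a b : V, p 0 a (T b) = T (p 0 a b) := fun a b => by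
    simpa using (htrans2 0 a b).symm
  have htr1 : ∀ a b : V, p 1 a (T b) = T (p 1 a b) + p 0 a b := fun a b => by
    simpa using (htrans2 1 a b).symm
  have htl0 : ∀ a b : V, p 0 (T a) b = 0 := fun a b => by simpa using htrans1 0 a b
  have htl1 : ∀ a b : V, p 1 (T a) b = -p 0 a b := fun a b => by simpa using htrans1 1 a b
  have htl2 : ∀ a b : V, p 2 (T a) b = -(2 : ℂ) • p 1 a b := fun a b => by
    simpa using htrans1 2 a b
  have hBcomm : ∀ a ∈ A, ∀ b ∈ A, ∀ c ∈ A, B a (B b c) = B b (B a c) := by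
    intro a ha b hb c hc
    have h1 := hBA b hb c hc
    have h2 := hBA a ha c hc
    refine hinj _ (hBP a ha _ h1) _ (hBP b hb _ h2) ?_
    refine hinj _ (hTP _) _ (hTP _) ?_
    rw [hBT a ha _ h1, hBT b hb _ h2, ← htr0, ← htr0, hBT b hb c hc, hBT a ha c hc]
    have h := hcomm0 0 a b c
    rw [← hBT a ha b hb] at h
    simp only [Nat.cast_zero, htl0] at h
    exact sub_eq_zero.mp h
  have hmixed : ∀ a ∈ A, ∀ b ∈ A, ∀ c ∈ A,
      p 1 a (B b c) + B a (B b c) = B b (p 1 a c) + B (C a b) c := by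
    intro a ha b hb c hc
    have h1 := hBA b hb c hc
    have h2 := hclosed 1 a ha c hc
    have h3 := hCA a ha b hb
    refine hinj _ (P.add_mem (hone a ha _ h1) (hBP a ha _ h1)) _
      (P.add_mem (hBP b hb _ h2) (hBP _ h3 c hc)) ?_
    rw [map_add, map_add, hBT a ha _ h1, hBT b hb _ h2, hBT _ h3 c hc, ← htr1, hBT b hb c hc,
      hC, map_sub, LinearMap.sub_apply]
    have h := hcomm1 0 a b c
    rw [← hBT a ha b hb] at h
    simp only [Nat.cast_zero, add_zero, htl1] at h
    rw [sub_eq_iff_eq_add] at h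
    rw [h]; abel
  have hBsub : ∀ a ∈ A, ∀ x ∈ A, ∀ y ∈ A, B a (x - y) = B a x - B a y := by
    intro a ha x hx y hy
    refine hinj _ (hBP a ha _ (A.sub_mem hx hy)) _ (P.sub_mem (hBP a ha x hx) (hBP a ha y hy)) ?_
    rw [map_sub, hBT a ha _ (A.sub_mem hx hy), hBT a ha x hx, hBT a ha y hy, map_sub]
  have hskew0 : ∀ a ∈ A, ∀ b ∈ A, ∃ y ∈ A, p 0 a b = -p 0 b a + T (p 1 b a) + T (T y) := by
    intro a ha b hb
    obtain ⟨N, hN⟩ := hfin b a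
    refine ⟨∑ k ∈ Finset.range N.toNat,
      ((-1 : ℂ) ^ (((k + 2 : ℕ) : ℤ) + 0 + 1) / (Nat.factorial (k + 2) : ℂ)) •
        (T ^ k) (p (0 + ((k + 2 : ℕ) : ℤ)) b a), ?_, ?_⟩
    · refine A.sum_mem fun k _ => A.smul_mem _ ?_
      exact Module.End.pow_apply_mem_of_forall_mem k hTA _ (hclosed _ b hb a ha)
    · rw [hskew 0 a b, finsum_eq_sum_of_support_subset (s := Finset.range (N.toNat + 2)) _ (by
        intro k hk
        by_contra hk'
        simp only [Finset.coe_range, Set.mem_Iio, not_lt] at hk'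
        apply hk
        simp only [hN (0 + (k : ℤ)) (by omega), map_zero, smul_zero])]
      rw [Finset.sum_range_succ', Finset.sum_range_succ', map_sum, map_sum]
      have hcong : ∀ k : ℕ, T (T (((-1 : ℂ) ^ (((k + 2 : ℕ) : ℤ) + 0 + 1) /
          (Nat.factorial (k + 2) : ℂ)) • (T ^ k) (p (0 + ((k + 2 : ℕ) : ℤ)) b a))) =
          ((-1 : ℂ) ^ (((k + 1 + 1 : ℕ) : ℤ) + 0 + 1) / (Nat.factorial (k + 1 + 1) : ℂ)) •
            (T ^ (k + 1 + 1)) (p (0 + ((k + 1 + 1 : ℕ) : ℤ)) b a) := by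
        intro k
        rw [map_smul, map_smul, pow_succ' T (k + 1), pow_succ' T k]
        rfl
      simp only [hcong]
      simp
      abel
  have hsym : ∀ a ∈ A, ∀ b ∈ A, ∃ y ∈ A, p 1 b a - B a b - B b a = T y := by
    intro a ha b hb
    obtain ⟨y, hy, h⟩ := hskew0 a ha b hb
    refine ⟨-y, A.neg_mem hy, hinj _ ?_ _ (hTP _) ?_⟩
    · exact P.sub_mem (P.sub_mem (hone b hb a ha) (hBP a ha b hb)) (hBP b hb a ha)
    · rw [map_sub, map_sub, hBT a ha b hb, hBT b hb a ha, h, map_neg, map_neg]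
      abel
  intro a ha b hb c hc
  obtain ⟨y, hy, h⟩ := hsym a ha b hb
  refine Submodule.neg_mem_iff _ |>.mp ?_
  have h0 := hDijk y hy c hc
  convert h0 using 1
  have e1 := hmixed a ha b hb c hc
  have e2 := hmixed b hb a ha c hc
  have e3 := hBcomm a ha b hb c hc
  have e4 := hcomm1 1 a b c
  have e5 : p 1 (p 1 b a) c - p 1 (B a b) c - p 1 (B b a) c = -p 0 y c := by
    rw [← htl1, ← h]; simp
  rw [← hBT a ha b hb] at e4
  norm_num [htl2] at e4
  have e6 := hBsub a ha _ (hclosed 1 b hb c hc) _ (hBA b hb c hc)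
  have e7 := hBsub b hb _ (hclosed 1 a ha c hc) _ (hBA a ha c hc)
  have e8 : p 1 a (C b c) = p 1 a (p 1 b c) - p 1 a (B b c) := by rw [hC, map_sub]
  have e9 : p 1 b (C a c) = p 1 b (p 1 a c) - p 1 b (B a c) := by rw [hC, map_sub]
  have e10 : p 1 (C a b) c = p 1 (p 1 a b) c - p 1 (B a b) c := by
    rw [hC, map_sub, LinearMap.sub_apply]
  have e11 : p 1 (C b a) c = p 1 (p 1 b a) c - p 1 (B b a) c := by
    rw [hC, map_sub, LinearMap.sub_apply]
  rw [← hC] at e6 e7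
  rw [hC a (C b c), hC b (C a c), hC (C a b) c, hC (C b a) c, e6, e7, e8, e9, e10, e11]
  linear_combination (norm := module) e1 - e2 - (2 : ℂ) • e3 - e4 - e5
end

section
/- Skew relation between B and C: for all a, b ∈ A, the element C(a, b) − B(b, a) lies in T(A). -/
open scoped BigOperators

/-- In a sequence of skew-symmetry terms that eventually vanishes, everything beyond order one
can be collected into the image under `T ^ 2` of a single element. -/
theorem exists_finsum_eq_add_add_sq {V : Type*} [AddCommGroup V] [Module ℂ V]
    (T : V →ₗ[ℂ] V) (A : Submodule ℂ V) (hTA : ∀ a ∈ A, T a ∈ A)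
    (c : ℕ → ℂ) (f : ℕ → V) (hf : ∀ k, f k ∈ A) (N : ℕ) (hN : ∀ k, N ≤ k → f k = 0) :
    ∃ s ∈ A, ∑ᶠ k : ℕ, c k • (T ^ k) (f k) = c 0 • f 0 + c 1 • T (f 1) + T (T s) := by
  have hpow : ∀ k, ∀ x ∈ A, (T ^ k) x ∈ A := by
    intro k
    induction k with
    | zero => intro x hx; simpa using hx
    | succ k ih => intro x hx; rw [pow_succ']; exact hTA _ (ih x hx)
  refine ⟨∑ k ∈ Finset.range N, c (k + 2) • (T ^ k) (f (k + 2)),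
    Submodule.sum_mem _ fun k _ => A.smul_mem _ (hpow _ _ (hf _)), ?_⟩
  have hsupp : (Function.support fun k : ℕ => c k • (T ^ k) (f k)) ⊆
      (Finset.range (N + 2) : Finset ℕ) := by
    intro k hk
    by_contra hk'
    have hNk : N ≤ k := by
      simp only [Finset.coe_range, Set.mem_Iio] at hk'
      omega
    exact hk (by simp [hN k hNk])
  rw [finsum_eq_sum_of_support_subset _ hsupp, Finset.sum_range_succ', Finset.sum_range_succ']
  simp only [map_sum, map_smul, pow_succ', pow_zero, Module.End.mul_apply, Module.End.one_apply]
  abel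

/-- A bilinear map sends `A × A` into `W` as soon as it does so on homogeneous elements. -/
theorem bilin_mem_of_homogeneous {V : Type*} [AddCommGroup V] [Module ℂ V]
    (Vgr : ℕ → Submodule ℂ V) (A W : Submodule ℂ V) (hAgraded : A = ⨆ n : ℕ, (A ⊓ Vgr n))
    (q : V →ₗ[ℂ] V →ₗ[ℂ] V)
    (hq : ∀ m k, ∀ a ∈ A ⊓ Vgr m, ∀ b ∈ A ⊓ Vgr k, q a b ∈ W) :
    ∀ a ∈ A, ∀ b ∈ A, q a b ∈ W := by
  intro a ha b hb
  rw [hAgraded] at ha hb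
  have hle : (⨆ n : ℕ, (A ⊓ Vgr n)) ≤ W.comap (q.flip b) := by
    refine iSup_le fun m a ha => ?_
    have hle' : (⨆ n : ℕ, (A ⊓ Vgr n)) ≤ W.comap (q a) :=
      iSup_le fun k b hb => hq m k a ha b hb
    exact hle' hb
  exact hle ha

/-- Skew relation between `B` and `C`: `C(a, b) − B(b, a) ∈ T(A)`. -/
theorem skew_relation_B_C
    {V : Type*} [AddCommGroup V] [Module ℂ V]
    (Vgr : ℕ → Submodule ℂ V)
    (hinternal : DirectSum.IsInternal Vgr)
    (T : V →ₗ[ℂ] V)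
    (hTgrade : ∀ (n : ℕ), ∀ x ∈ Vgr n, T x ∈ Vgr (n + 1))
    (p : ℤ → V →ₗ[ℂ] V →ₗ[ℂ] V)
    (hgrade : ∀ (m k : ℕ) (n : ℤ), ∀ a ∈ Vgr m, ∀ b ∈ Vgr k,
      p n a b ∈ gradeZ Vgr ((m : ℤ) + (k : ℤ) - n - 1))
    (hfin : ∀ a b : V, ∃ N : ℤ, ∀ n : ℤ, N ≤ n → p n a b = 0)
    (htrans1 : ∀ (n : ℤ) (a b : V), p n (T a) b = (-(n : ℂ)) • p (n - 1) a b)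
    (htrans2 : ∀ (n : ℤ) (a b : V),
      T (p n a b) + (n : ℂ) • p (n - 1) a b = p n a (T b))
    (hskew : ∀ (n : ℤ) (a b : V),
      p n a b = ∑ᶠ k : ℕ, ((-1 : ℂ) ^ ((k : ℤ) + n + 1) / (Nat.factorial k : ℂ)) •
        ((T ^ k) (p (n + (k : ℤ)) b a)))
    (hcomm : ∀ (m n : ℕ) (a b c : V),
      p (m : ℤ) a (p (n : ℤ) b c) - p (n : ℤ) b (p (m : ℤ) a c) =
        ∑ᶠ k : ℕ, (Nat.choose m k : ℂ) • p ((m : ℤ) + (n : ℤ) - (k : ℤ)) (p (k : ℤ) a b) c)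
    (hker : ∀ x : V, T x = 0 → x ∈ Vgr 0)
    (A : Submodule ℂ V)
    (hAgraded : A = ⨆ n : ℕ, (A ⊓ Vgr n))
    (hTA : ∀ a ∈ A, T a ∈ A)
    (hclosed : ∀ (n : ℤ), ∀ a ∈ A, ∀ b ∈ A, p n a b ∈ A)
    (hA1 : A ⊓ Vgr 1 = ⊥)
    (hDijk : ∀ a ∈ A, ∀ b ∈ A, p 0 a b ∈ A.map T)
    (B : V → V → V)
    (hB : ∀ a ∈ A, ∀ b ∈ A,
      B a b ∈ A ⊓ (⨆ (n : ℕ) (_ : 1 ≤ n), Vgr n) ∧ T (B a b) = p 0 a b)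
    (C : V → V → V)
    (hC : ∀ a b : V, C a b = p 1 a b - B a b) :
    ∀ a ∈ A, ∀ b ∈ A, C a b - B b a ∈ A.map T := by
  set W : Submodule ℂ V := ⨆ (n : ℕ) (_ : 1 ≤ n), Vgr n with hW
  have hle : ∀ n, 1 ≤ n → Vgr n ≤ W := fun n hn =>
    le_iSup₂_of_le (f := fun (n : ℕ) (_ : 1 ≤ n) => Vgr n) n hn le_rfl
  have hTW : ∀ x, T x ∈ W := by
    intro x
    have hx : x ∈ ⨆ n, Vgr n := by
      rw [hinternal.submodule_iSup_eq_top]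
      trivial
    have hcomap : (⨆ n, Vgr n) ≤ W.comap T :=
      iSup_le fun n y hy => hle (n + 1) (by omega) (hTgrade n y hy)
    exact hcomap hx
  have hdisj : ∀ x ∈ Vgr 0, x ∈ W → x = 0 := by
    intro x hx0 hxW
    have hd := hinternal.submodule_iSupIndep 0
    refine Submodule.disjoint_def.mp hd x hx0 ?_
    have hmono : W ≤ ⨆ (j : ℕ) (_ : j ≠ 0), Vgr j :=
      iSup₂_le fun n hn => le_iSup₂_of_le (f := fun (j : ℕ) (_ : j ≠ 0) => Vgr j) n
        (by omega) le_rfl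
    exact hmono hxW
  have hzero : ∀ x ∈ A ⊓ Vgr 1, x = 0 := fun x hx => by
    rwa [hA1, Submodule.mem_bot] at hx
  have hT0 : ∀ x ∈ A ⊓ Vgr 0, T x = 0 := fun x hx =>
    hzero _ ⟨hTA x hx.1, hTgrade 0 x hx.2⟩
  have hp1 : ∀ a ∈ A, ∀ b ∈ A, p 1 a b ∈ W := by
    refine bilin_mem_of_homogeneous Vgr A W hAgraded (p 1) fun m k a ha b hb => ?_
    obtain rfl | rfl | hm : m = 0 ∨ m = 1 ∨ 2 ≤ m := by omega
    · have h := htrans1 2 a b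
      rw [hT0 a ha] at h
      have h1 : p 1 a b = 0 := by simpa using h
      simp [h1]
    · simp [hzero a ha]
    obtain rfl | rfl | hk : k = 0 ∨ k = 1 ∨ 2 ≤ k := by omega
    · have h := htrans2 2 a b
      rw [hT0 b hb, map_zero] at h
      norm_num at h
      have h2 : (2 : ℂ) • p 1 a b ∈ W := by
        rw [eq_neg_of_add_eq_zero_right h]
        exact W.neg_mem (hTW _)
      exact (W.smul_mem_iff two_ne_zero).mp h2
    · simp [hzero b hb]
    · have h := hgrade m k 1 a ha.2 b hb.2
      rw [gradeZ, if_pos (by omega)] at h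
      exact hle _ (by omega) h
  intro a ha b hb
  obtain ⟨N, hN⟩ := hfin a b
  obtain ⟨s, hs, hsum⟩ := exists_finsum_eq_add_add_sq T A hTA
    (fun k => (-1 : ℂ) ^ ((k : ℤ) + 0 + 1) / (Nat.factorial k : ℂ))
    (fun k => p (0 + (k : ℤ)) a b) (fun k => hclosed _ a ha b hb) N.toNat
    (fun k hk => hN _ (by omega))
  rw [← hskew 0 b a] at hsum
  norm_num at hsum
  obtain ⟨hBab, hTab⟩ := hB a ha b hb
  obtain ⟨hBba, hTba⟩ := hB b hb a ha
  have hx : p 1 a b - B a b - B b a + T s = 0 := by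
    refine hdisj _ (hker _ ?_) ?_
    · rw [map_add, map_sub, map_sub, hTab, hTba, hsum]
      abel
    · exact W.add_mem (W.sub_mem (W.sub_mem (hp1 a ha b hb) hBab.2) hBba.2) (hTW s)
  rw [hC, eq_neg_of_add_eq_zero_left hx]
  exact Submodule.neg_mem _ (Submodule.mem_map_of_mem hs)
end

section
/- Iterated contact relation: let r ≥ 1, let a, c, b₁, …, b_r ∈ A, define Φ : A → A by Φ(x) = B(b_r, B(b_{r−1}, …, B(b₁, x)…)) (the r-fold nested B with arguments b_r, …, b₁ applied to x), and for 1 ≤ l ≤ r let Φ_l(x) denote the same nested expression with b_l replaced by C(a, b_l). Then C(a, Φ(c)) − Φ(C(a, c)) + r·Φ(B(a, c)) = ∑_{l=1}^{r} Φ_l(c). -/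
open scoped BigOperators

/-- Nested application of `B`: `nestB B b x = B (b r) (B (b (r-1)) (… B (b 1) x …))`,
i.e. the innermost application uses `b 0` and the outermost uses `b (r-1)`. -/
def nestB {V : Type*} (B : V → V → V) {r : ℕ} (b : Fin r → V) (x : V) : V :=
  (List.ofFn b).foldl (fun y t => B t y) x

theorem nestB_succ {V : Type*} (B : V → V → V) {r : ℕ} (b : Fin (r + 1) → V) (x : V) :
    nestB B b x = B (b (Fin.last r)) (nestB B (fun i => b i.castSucc) x) := by
  rw [nestB, List.ofFn_succ', List.concat_eq_append, List.foldl_append]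
  rfl

section NestB

variable {V : Type*} [AddCommGroup V] [Module ℂ V]

theorem nestB_mem {A : Submodule ℂ V} {B : V → V → V}
    (hBA : ∀ a ∈ A, ∀ b ∈ A, B a b ∈ A) {r : ℕ} (b : Fin r → V) (hb : ∀ l, b l ∈ A)
    {x : V} (hx : x ∈ A) : nestB B b x ∈ A := by
  induction r with
  | zero => simpa [nestB] using hx
  | succ r ih =>
    rw [nestB_succ]
    exact hBA _ (hb _) _ (ih _ fun l => hb _)

theorem nestB_left_comm {A : Submodule ℂ V} {B : V → V → V}
    (hBA : ∀ a ∈ A, ∀ b ∈ A, B a b ∈ A)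
    (hcomm : ∀ a ∈ A, ∀ b ∈ A, ∀ c ∈ A, B a (B b c) = B b (B a c))
    {r : ℕ} (b : Fin r → V) (hb : ∀ l, b l ∈ A) {a x : V} (ha : a ∈ A) (hx : x ∈ A) :
    B a (nestB B b x) = nestB B b (B a x) := by
  induction r with
  | zero => simp [nestB]
  | succ r ih =>
    rw [nestB_succ, nestB_succ, hcomm _ ha _ (hb _) _ (nestB_mem hBA _ (fun l => hb _) hx),
      ih _ fun l => hb _]

/-- The iterated relation follows formally from the case `r = 1` when the maps `B b` are linear
on `A` and commute with each other. -/
theorem nestB_contact_relation {A : Submodule ℂ V} {B C : V → V → V}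
    (hBA : ∀ a ∈ A, ∀ b ∈ A, B a b ∈ A)
    (hCA : ∀ a ∈ A, ∀ b ∈ A, C a b ∈ A)
    (hadd : ∀ a ∈ A, ∀ x ∈ A, ∀ y ∈ A, B a (x + y) = B a x + B a y)
    (hsmul : ∀ a ∈ A, ∀ (s : ℂ), ∀ x ∈ A, B a (s • x) = s • B a x)
    (hcomm : ∀ a ∈ A, ∀ b ∈ A, ∀ c ∈ A, B a (B b c) = B b (B a c))
    (hcontact : ∀ a ∈ A, ∀ b ∈ A, ∀ c ∈ A,
      C a (B b c) = B b (C a c) - B b (B a c) + B (C a b) c)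
    {r : ℕ} (b : Fin r → V) (hb : ∀ l, b l ∈ A) {a c : V} (ha : a ∈ A) (hc : c ∈ A) :
    C a (nestB B b c) - nestB B b (C a c) + (r : ℂ) • nestB B b (B a c)
      = ∑ l : Fin r, nestB B (Function.update b l (C a (b l))) c := by
  have hsum : ∀ d ∈ A, ∀ {n : ℕ} (f : Fin n → V), (∀ l, f l ∈ A) →
      B d (∑ l, f l) = ∑ l, B d (f l) := by
    intro d hd n f hf
    induction n with
    | zero => simpa using hsmul d hd 0 0 A.zero_mem
    | succ n ih =>
      rw [Fin.sum_univ_castSucc, Fin.sum_univ_castSucc,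
        hadd d hd _ (A.sum_mem fun l _ => hf _) _ (hf _), ih _ fun l => hf _]
  induction r with
  | zero => simp [nestB]
  | succ r ih =>
    let b' : Fin r → V := fun i => b i.castSucc
    have hb' : ∀ l, b' l ∈ A := fun l => hb _
    have hd : b (Fin.last r) ∈ A := hb _
    have hN : ∀ {x}, x ∈ A → nestB B b' x ∈ A := nestB_mem hBA b' hb'
    have hupd : ∀ l : Fin r, nestB B (Function.update b' l (C a (b' l))) c ∈ A := by
      intro l
      refine nestB_mem hBA _ (fun k => ?_) hc
      rcases eq_or_ne k l with rfl | h
      · simpa using hCA a ha _ (hb' k)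
      · simpa [h] using hb' k
    have hCc := hN (hCA a ha c hc)
    have hBc := hN (hBA a ha c hc)
    have ih' : C a (nestB B b' c) + (r : ℂ) • nestB B b' (B a c)
        = nestB B b' (C a c) + ∑ l, nestB B (Function.update b' l (C a (b' l))) c := by
      rw [← ih b' hb']
      abel
    have key := congrArg (B (b (Fin.last r))) ih'
    rw [hadd _ hd _ (hCA a ha _ (hN hc)) _ (A.smul_mem _ hBc), hsmul _ hd _ _ hBc,
      hadd _ hd _ hCc _ (A.sum_mem fun l _ => hupd l), hsum _ hd _ hupd] at key
    have hcast : ∀ l : Fin r, nestB B (Function.update b l.castSucc (C a (b l.castSucc))) c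
        = B (b (Fin.last r)) (nestB B (Function.update b' l (C a (b' l))) c) := by
      intro l
      rw [nestB_succ, Function.update_of_ne (Fin.castSucc_lt_last l).ne']
      congr 2
      funext k
      simp [Function.update_apply, b']
    have hlast : nestB B (Function.update b (Fin.last r) (C a (b (Fin.last r)))) c
        = B (C a (b (Fin.last r))) (nestB B b' c) := by
      rw [nestB_succ, Function.update_self]
      congr 2
      funext k
      simp [b', (Fin.castSucc_lt_last k).ne]
    rw [Fin.sum_univ_castSucc, Finset.sum_congr rfl fun l _ => hcast l, hlast]
    simp only [nestB_succ]
    change C a (B _ (nestB B b' c)) - B _ (nestB B b' (C a c))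
      + _ • B _ (nestB B b' (B a c)) = _
    rw [hcontact a ha _ hd _ (hN hc), nestB_left_comm hBA hcomm b' hb' ha hc,
      eq_sub_of_add_eq key]
    push_cast
    module

end NestB

/-- Iterated contact relation (Proposition 2.16):
`C(a, Φ(c)) − Φ(C(a, c)) + r·Φ(B(a, c)) = ∑_{l=1}^{r} Φ_l(c)`. -/
theorem iterated_contact_relation
    {V : Type*} [AddCommGroup V] [Module ℂ V]
    (Vgr : ℕ → Submodule ℂ V)
    (hinternal : DirectSum.IsInternal Vgr)
    (T : V →ₗ[ℂ] V)
    (hTgrade : ∀ (n : ℕ), ∀ x ∈ Vgr n, T x ∈ Vgr (n + 1))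
    (p : ℤ → V →ₗ[ℂ] V →ₗ[ℂ] V)
    (hgrade : ∀ (m k : ℕ) (n : ℤ), ∀ a ∈ Vgr m, ∀ b ∈ Vgr k,
      p n a b ∈ gradeZ Vgr ((m : ℤ) + (k : ℤ) - n - 1))
    (hfin : ∀ a b : V, ∃ N : ℤ, ∀ n : ℤ, N ≤ n → p n a b = 0)
    (htrans1 : ∀ (n : ℤ) (a b : V), p n (T a) b = (-(n : ℂ)) • p (n - 1) a b)
    (htrans2 : ∀ (n : ℤ) (a b : V),
      T (p n a b) + (n : ℂ) • p (n - 1) a b = p n a (T b))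
    (hskew : ∀ (n : ℤ) (a b : V),
      p n a b = ∑ᶠ k : ℕ, ((-1 : ℂ) ^ ((k : ℤ) + n + 1) / (Nat.factorial k : ℂ)) •
        ((T ^ k) (p (n + (k : ℤ)) b a)))
    (hcomm : ∀ (m n : ℕ) (a b c : V),
      p (m : ℤ) a (p (n : ℤ) b c) - p (n : ℤ) b (p (m : ℤ) a c) =
        ∑ᶠ k : ℕ, (Nat.choose m k : ℂ) • p ((m : ℤ) + (n : ℤ) - (k : ℤ)) (p (k : ℤ) a b) c)
    (hker : ∀ x : V, T x = 0 → x ∈ Vgr 0)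
    (A : Submodule ℂ V)
    (hAgraded : A = ⨆ n : ℕ, (A ⊓ Vgr n))
    (hTA : ∀ a ∈ A, T a ∈ A)
    (hclosed : ∀ (n : ℤ), ∀ a ∈ A, ∀ b ∈ A, p n a b ∈ A)
    (hA1 : A ⊓ Vgr 1 = ⊥)
    (hDijk : ∀ a ∈ A, ∀ b ∈ A, p 0 a b ∈ A.map T)
    (B : V → V → V)
    (hB : ∀ a ∈ A, ∀ b ∈ A,
      B a b ∈ A ⊓ (⨆ (n : ℕ) (_ : 1 ≤ n), Vgr n) ∧ T (B a b) = p 0 a b)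
    (C : V → V → V)
    (hC : ∀ a b : V, C a b = p 1 a b - B a b) :
    ∀ (r : ℕ), 1 ≤ r → ∀ a ∈ A, ∀ c ∈ A, ∀ b : Fin r → V, (∀ l, b l ∈ A) →
      C a (nestB B b c) - nestB B b (C a c) + (r : ℂ) • nestB B b (B a c)
        = ∑ l : Fin r, nestB B (Function.update b l (C a (b l))) c := by
  set P : Submodule ℂ V := ⨆ (n : ℕ) (_ : 1 ≤ n), Vgr n
  have hVP : ∀ n : ℕ, 1 ≤ n → Vgr n ≤ P := fun n hn => le_iSup₂_of_le n hn le_rfl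
  have hinj : ∀ x ∈ P, T x = 0 → x = 0 := by
    intro x hx hTx
    have hdisj := hinternal.submodule_iSupIndep 0
    refine Submodule.disjoint_def.1 hdisj x (hker x hTx) ?_
    have hle : P ≤ ⨆ (j : ℕ) (_ : j ≠ 0), Vgr j :=
      iSup₂_le fun n hn => le_iSup₂_of_le n (by lia) le_rfl
    exact hle hx
  have hinj' : ∀ x ∈ P, ∀ y ∈ P, T x = T y → x = y := fun x hx y hy h =>
    sub_eq_zero.1 (hinj _ (P.sub_mem hx hy) (by rw [map_sub, h, sub_self]))
  have hBA : ∀ a ∈ A, ∀ b ∈ A, B a b ∈ A := fun a ha b hb => (hB a ha b hb).1.1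
  have hBP : ∀ a ∈ A, ∀ b ∈ A, B a b ∈ P := fun a ha b hb => (hB a ha b hb).1.2
  have hTB : ∀ a ∈ A, ∀ b ∈ A, T (B a b) = p 0 a b := fun a ha b hb => (hB a ha b hb).2
  have hCA : ∀ a ∈ A, ∀ b ∈ A, C a b ∈ A := fun a ha b hb => by
    rw [hC]
    exact A.sub_mem (hclosed 1 a ha b hb) (hBA a ha b hb)
  -- Elements of `A` of degree zero are translation invariant, so only their `-1` product survives.
  have hzero : ∀ a ∈ A, a ∈ Vgr 0 → ∀ n : ℤ, n ≠ -1 → ∀ b, p n a b = 0 := by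
    intro a ha ha0 n hn b
    have hTa : T a = 0 := by
      have : T a ∈ A ⊓ Vgr 1 := ⟨hTA a ha, hTgrade 0 a ha0⟩
      rwa [hA1, Submodule.mem_bot] at this
    have h := htrans1 (n + 1) a b
    rw [hTa, map_zero, LinearMap.zero_apply, add_sub_cancel_right] at h
    refine (smul_eq_zero.1 h.symm).resolve_left ?_
    exact neg_ne_zero.2 (Int.cast_ne_zero.2 (by lia))
  have hone : ∀ a ∈ A, a ∈ Vgr 1 → a = 0 := fun a ha ha1 => by
    have : a ∈ A ⊓ Vgr 1 := ⟨ha, ha1⟩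
    rwa [hA1, Submodule.mem_bot] at this
  have hpP_hom : ∀ m k : ℕ, ∀ a ∈ A ⊓ Vgr m, ∀ b ∈ A ⊓ Vgr k, p 1 a b ∈ P := by
    rintro m k a ⟨ha, ham⟩ b ⟨hb, hbk⟩
    by_cases hmk : 3 ≤ m + k
    · have h := hgrade m k 1 a ham b hbk
      rw [gradeZ, if_pos (by lia)] at h
      exact hVP _ (by lia) h
    · suffices p 1 a b = 0 by rw [this]; exact P.zero_mem
      rcases Nat.eq_zero_or_pos m with rfl | hm
      · exact hzero a ha ham 1 (by norm_num) b
      rcases Nat.eq_zero_or_pos k with rfl | hk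
      · rw [hskew]
        refine finsum_eq_zero_of_forall_eq_zero fun j => ?_
        rw [hzero b hb hbk _ (by lia) a, map_zero, smul_zero]
      · obtain rfl : m = 1 := by lia
        rw [hone a ha ham, map_zero, LinearMap.zero_apply]
  have hpP : ∀ a ∈ A, ∀ b ∈ A, p 1 a b ∈ P := by
    intro a ha b hb
    rw [hAgraded] at ha hb
    refine Submodule.iSup_induction _ (motive := fun a => p 1 a b ∈ P) ha (fun m a ha => ?_)
      (by simp) (fun x y hx hy => by simpa using P.add_mem hx hy)
    refine Submodule.iSup_induction _ (motive := fun b => p 1 a b ∈ P) hb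
      (fun k b hb => hpP_hom m k a ha b hb)
      (by simp) (fun x y hx hy => by simpa using P.add_mem hx hy)
  have hCP : ∀ a ∈ A, ∀ b ∈ A, C a b ∈ P := fun a ha b hb => by
    rw [hC]
    exact P.sub_mem (hpP a ha b hb) (hBP a ha b hb)
  have hadd : ∀ a ∈ A, ∀ x ∈ A, ∀ y ∈ A, B a (x + y) = B a x + B a y := by
    intro a ha x hx y hy
    refine hinj' _ (hBP a ha _ (A.add_mem hx hy)) _
      (P.add_mem (hBP a ha x hx) (hBP a ha y hy)) ?_
    rw [map_add, hTB a ha _ (A.add_mem hx hy), hTB a ha x hx, hTB a ha y hy, map_add]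
  have hsmul : ∀ a ∈ A, ∀ (s : ℂ), ∀ x ∈ A, B a (s • x) = s • B a x := by
    intro a ha s x hx
    refine hinj' _ (hBP a ha _ (A.smul_mem s hx)) _ (P.smul_mem s (hBP a ha x hx)) ?_
    rw [map_smul, hTB a ha _ (A.smul_mem s hx), hTB a ha x hx, map_smul]
  have hTp0 : ∀ a x, p 0 a (T x) = T (p 0 a x) := fun a x => by
    simpa using (htrans2 0 a x).symm
  have hTTB : ∀ a ∈ A, ∀ b ∈ A, ∀ c ∈ A, T (T (B a (B b c))) = p 0 a (p 0 b c) := by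
    intro a ha b hb c hc
    rw [hTB a ha _ (hBA b hb c hc), ← hTp0, hTB b hb c hc]
  have hcomm0 : ∀ a ∈ A, ∀ b ∈ A, ∀ c, p 0 a (p 0 b c) = p 0 b (p 0 a c) := by
    intro a ha b hb c
    have h := hcomm 0 0 a b c
    rw [finsum_eq_single _ 0 fun k hk => by
      rw [Nat.choose_eq_zero_of_lt (Nat.pos_of_ne_zero hk), Nat.cast_zero, zero_smul]] at h
    have h0 : p 0 (p 0 a b) c = 0 := by
      rw [← hTB a ha b hb, htrans1]
      simp
    simp only [Nat.cast_zero, add_zero, sub_zero, h0, smul_zero] at h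
    exact sub_eq_zero.1 h
  have hp0P : ∀ a ∈ A, ∀ b ∈ A, T (B a b) ∈ P := by
    intro a ha b hb
    have hTP : P ≤ P.comap T :=
      iSup₂_le fun n hn x hx => hVP (n + 1) (by lia) (hTgrade n x hx)
    exact hTP (hBP a ha b hb)
  have hBcomm : ∀ a ∈ A, ∀ b ∈ A, ∀ c ∈ A, B a (B b c) = B b (B a c) := by
    intro a ha b hb c hc
    have hbc := hBA b hb c hc
    have hac := hBA a ha c hc
    refine hinj' _ (hBP a ha _ hbc) _ (hBP b hb _ hac) ?_
    refine hinj' _ (hp0P a ha _ hbc) _ (hp0P b hb _ hac) ?_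
    rw [hTTB a ha b hb c hc, hTTB b hb a ha c hc, hcomm0 a ha b hb]
  have hcomm1 : ∀ a ∈ A, ∀ b ∈ A, ∀ c ∈ A,
      p 1 a (p 0 b c) - p 0 b (p 1 a c) = p 0 (C a b) c := by
    intro a ha b hb c hc
    have h := hcomm 1 0 a b c
    rw [finsum_eq_sum_of_support_subset (s := Finset.range 2) _ (by
      intro k hk
      by_contra hk'
      refine hk ?_
      simp only [Finset.coe_range, Set.mem_Iio, not_lt] at hk'
      simp [Nat.choose_eq_zero_of_lt (show 1 < k by lia)])] at h
    have h1 : p 1 (p 0 a b) c = -p 0 (B a b) c := by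
      rw [← hTB a ha b hb, htrans1]
      simp
    simp only [Finset.sum_range_succ, Finset.sum_range_zero, Nat.cast_zero, Nat.cast_one,
      add_zero, sub_zero, zero_add, sub_self, Nat.choose_zero_right, Nat.choose_self, one_smul,
      h1] at h
    rw [h, hC, map_sub, LinearMap.sub_apply]
    abel
  have hcontact : ∀ a ∈ A, ∀ b ∈ A, ∀ c ∈ A,
      C a (B b c) = B b (C a c) - B b (B a c) + B (C a b) c := by
    intro a ha b hb c hc
    have hbc := hBA b hb c hc
    have hac := hBA a ha c hc
    have hCab := hCA a ha b hb
    have hCac := hCA a ha c hc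
    refine hinj' _ (hCP a ha _ hbc) _
      (P.add_mem (P.sub_mem (hBP b hb _ hCac) (hBP b hb _ hac)) (hBP _ hCab c hc)) ?_
    have h1 := htrans2 1 a (B b c)
    rw [hTB b hb c hc, Int.cast_one, one_smul, sub_self] at h1
    have h2 : p 0 a (B b c) = p 0 b (B a c) := by
      rw [← hTB a ha _ hbc, ← hTB b hb _ hac, hBcomm a ha b hb c hc]
    rw [map_add, map_sub, hTB b hb _ hCac, hTB b hb _ hac, hTB _ hCab c hc,
      ← hcomm1 a ha b hb c hc, hC a (B b c), map_sub, hTB a ha _ hbc, hC a c, map_sub, ← h1, h2]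
    abel
  intro r _ a ha c hc b hb
  exact nestB_contact_relation hBA hCA hadd hsmul hBcomm hcontact b hb ha hc
end

section
/- Under Dijkgraaf's condition: (1) for all a, b ∈ A and all c ∈ V, a₍₀₎(b₍₀₎c) = b₍₀₎(a₍₀₎c), i.e. the operators a₍₀₎ and b₍₀₎ commute; (2) T(A ∩ V₀) = 0. -/
open scoped BigOperators

/-- Under Dijkgraaf's condition: (1) the zero-mode operators `a₍₀₎` and `b₍₀₎` commute for
`a, b ∈ A`; (2) `T(A ∩ V₀) = 0`. -/
theorem dijkgraaf_condition_consequences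
    {V : Type*} [AddCommGroup V] [Module ℂ V]
    (Vgr : ℕ → Submodule ℂ V)
    (T : V →ₗ[ℂ] V)
    (hTgrade : ∀ (n : ℕ), ∀ x ∈ Vgr n, T x ∈ Vgr (n + 1))
    (p : ℤ → V →ₗ[ℂ] V →ₗ[ℂ] V)
    (htrans1 : ∀ (n : ℤ) (a b : V), p n (T a) b = (-(n : ℂ)) • p (n - 1) a b)
    (hcomm : ∀ (m n : ℕ) (a b c : V),
      p (m : ℤ) a (p (n : ℤ) b c) - p (n : ℤ) b (p (m : ℤ) a c) =
        ∑ᶠ k : ℕ, (Nat.choose m k : ℂ) • p ((m : ℤ) + (n : ℤ) - (k : ℤ)) (p (k : ℤ) a b) c)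
    (A : Submodule ℂ V)
    (hAgraded : A = ⨆ n : ℕ, (A ⊓ Vgr n))
    (hTA : ∀ a ∈ A, T a ∈ A)
    (hclosed : ∀ (n : ℤ), ∀ a ∈ A, ∀ b ∈ A, p n a b ∈ A)
    (hA1 : A ⊓ Vgr 1 = ⊥)
    (hDijk : ∀ a ∈ A, ∀ b ∈ A, p 0 a b ∈ A.map T) :
    (∀ a ∈ A, ∀ b ∈ A, ∀ c : V, p 0 a (p 0 b c) = p 0 b (p 0 a c)) ∧
      (∀ x ∈ A ⊓ Vgr 0, T x = 0) := by
  refine ⟨fun a ha b hb c => ?_, fun x hx => ?_⟩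
  · obtain ⟨d, -, hd⟩ := hDijk a ha b hb
    have hT : p 0 (T d) c = 0 := by simpa using htrans1 0 d c
    have h := hcomm 0 0 a b c
    rw [finsum_eq_single _ 0 fun k hk => by
      simp [Nat.choose_eq_zero_of_lt (Nat.pos_of_ne_zero hk)]] at h
    simp only [Nat.cast_zero, add_zero, sub_zero, Nat.choose_self, Nat.cast_one, one_smul,
      ← hd, hT] at h
    exact sub_eq_zero.mp h
  · have h : T x ∈ A ⊓ Vgr 1 := ⟨hTA x hx.1, hTgrade 0 x hx.2⟩
    simpa [hA1] using h
end

section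
/- Kernel of the translation operator: ker L₋₁ ⊆ V₀. That is, if x ∈ V satisfies L₋₁ x = 0, then x ∈ V₀. -/
/-- In a graded `sl₂`-type situation, a homogeneous vector of degree `m` on which the composite
`L₁L₋₁` acts by `-c` with `c ≥ 0` and `c + 2m > 0` vanishes. -/
theorem eq_zero_of_lowering_raising_eq_neg
    {K : Type*} [Field K] [CharZero K] {V : Type*} [AddCommGroup V] [Module K V]
    (Vgr : ℕ → Submodule K V) (Lminus : V →ₗ[K] V) (Lplus : V →ₗ[K] V)
    (hLplus : ∀ n : ℕ, ∀ x ∈ Vgr (n + 1), Lplus x ∈ Vgr n)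
    (hLplus0 : ∀ x ∈ Vgr 0, Lplus x = 0)
    (hsl2 : ∀ (n : ℕ), ∀ x ∈ Vgr n,
      Lplus (Lminus x) - Lminus (Lplus x) = ((2 * n : ℕ) : K) • x)
    (m c : ℕ) (hc : 0 < c + 2 * m) (y : V) (hy : y ∈ Vgr m)
    (h : Lplus (Lminus y) = -((c : K) • y)) : y = 0 := by
  induction m generalizing c y with
  | zero =>
    have hcy : (c : K) • y = 0 := by
      simpa [hLplus0 y hy, h] using hsl2 0 y hy
    exact (smul_eq_zero.mp hcy).resolve_left (Nat.cast_ne_zero.mpr (by omega))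
  | succ m ih =>
    have key : Lminus (Lplus y) = -(((c + 2 * (m + 1) : ℕ) : K) • y) := by
      rw [← sub_sub_cancel (Lplus (Lminus y)) (Lminus (Lplus y)), hsl2 _ y hy, h, Nat.cast_add,
        add_smul, neg_add, sub_eq_add_neg]
    have hzero : Lplus y = 0 :=
      ih (c + 2 * (m + 1)) (by omega) (Lplus y) (hLplus m y hy) (by rw [key, map_neg, map_smul])
    rw [hzero, map_zero, eq_comm, neg_eq_zero] at key
    exact (smul_eq_zero.mp key).resolve_left (Nat.cast_ne_zero.mpr hc.ne')

/-- A linear map raising degree by one commutes with taking homogeneous components. -/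
theorem decompose_succ_apply_of_raises_degree
    {K : Type*} [Field K] {V : Type*} [AddCommGroup V] [Module K V]
    (Vgr : ℕ → Submodule K V) [DirectSum.Decomposition Vgr] (f : V →ₗ[K] V)
    (hf : ∀ n : ℕ, ∀ x ∈ Vgr n, f x ∈ Vgr (n + 1)) (x : V) (n : ℕ) :
    (DirectSum.decompose Vgr (f x) (n + 1) : V) = f (DirectSum.decompose Vgr x n) := by
  induction x using DirectSum.Decomposition.inductionOn Vgr with
  | zero => simp
  | @homogeneous i m =>
    obtain rfl | hin := eq_or_ne i n
    · rw [DirectSum.decompose_of_mem_same Vgr (hf i m m.2),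
        DirectSum.decompose_of_mem_same Vgr m.2]
    · rw [DirectSum.decompose_of_mem_ne Vgr (hf i m m.2) (by omega),
        DirectSum.decompose_of_mem_ne Vgr m.2 hin, map_zero]
  | add a b ha hb => simp [DirectSum.decompose_add, ha, hb]

/-- Kernel of the translation operator: if `L₋₁ x = 0` then `x ∈ V₀`.
Here `V = ⊕ₙ Vₙ` is an `ℕ`-graded vector space over a field of characteristic zero,
`L₋₁` raises degree by one, `L₁` lowers degree by one (and kills `V₀`), and the
`sl₂`-relation `L₁L₋₁ − L₋₁L₁ = 2L₀` holds, `L₀` acting on `Vₙ` by `n`. -/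
theorem ker_translation_subset_degree_zero
    {K : Type*} [Field K] [CharZero K]
    {V : Type*} [AddCommGroup V] [Module K V]
    (Vgr : ℕ → Submodule K V)
    (hinternal : DirectSum.IsInternal Vgr)
    (Lminus : V →ₗ[K] V) (Lplus : V →ₗ[K] V)
    (hLminus : ∀ n : ℕ, ∀ x ∈ Vgr n, Lminus x ∈ Vgr (n + 1))
    (hLplus : ∀ n : ℕ, ∀ x ∈ Vgr (n + 1), Lplus x ∈ Vgr n)
    (hLplus0 : ∀ x ∈ Vgr 0, Lplus x = 0)
    (hsl2 : ∀ (n : ℕ), ∀ x ∈ Vgr n,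
      Lplus (Lminus x) - Lminus (Lplus x) = ((2 * n : ℕ) : K) • x) :
    ∀ x : V, Lminus x = 0 → x ∈ Vgr 0 := by
  classical
  let := hinternal.chooseDecomposition
  intro x hx
  have hcomp (n : ℕ) (hn : n ≠ 0) : (DirectSum.decompose Vgr x n : V) = 0 := by
    have hker : Lminus (DirectSum.decompose Vgr x n) = 0 := by
      simp [← decompose_succ_apply_of_raises_degree Vgr Lminus hLminus x n, hx]
    exact eq_zero_of_lowering_raising_eq_neg Vgr Lminus Lplus hLplus hLplus0 hsl2 n 0
      (by omega) _ (DirectSum.decompose Vgr x n).2 (by simp [hker])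
  rw [← DirectSum.sum_support_decompose Vgr x]
  refine Submodule.sum_mem _ fun n _ => ?_
  obtain rfl | hn := eq_or_ne n 0
  · exact (DirectSum.decompose Vgr x 0).2
  · rw [hcomp n hn]
    exact Submodule.zero_mem _
end

section
/- Derivation identity underlying Lemma 2.10 (total-derivative form of the W_∞ OPE residue): for all integers m ≥ 2 and n ≥ 1 and all x, y ∈ A, ∑_{i=0}^{m−2} (−1)^i · (d^{m+n−3−i} x) ⋆ (d^i y) = ∑_{k=1}^{m−1} binom(m−1, k) · (−1)^{k−1} · d^{k−1}((d^{m+n−2−k} x) ⋆ y). -/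
/-- Both sides are `((a + c) ^ M - a ^ M) / c` when the quotient makes sense. -/
theorem Commute.sum_pow_mul_add_pow {R : Type*} [Semiring R] {a c : R} (h : Commute a c) (M : ℕ) :
    ∑ i ∈ Finset.range M, a ^ (M - 1 - i) * (a + c) ^ i
      = ∑ j ∈ Finset.range M, M.choose (j + 1) • (c ^ j * a ^ (M - 1 - j)) := by
  induction M with
  | zero => simp
  | succ M ih =>
    have hl : ∑ i ∈ Finset.range M, a ^ (M - i) * (a + c) ^ i
        = a * ∑ i ∈ Finset.range M, a ^ (M - 1 - i) * (a + c) ^ i := by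
      rw [Finset.mul_sum]
      refine Finset.sum_congr rfl fun i hi => ?_
      have hi := Finset.mem_range.mp hi
      rw [← mul_assoc, ← pow_succ', show M - 1 - i + 1 = M - i by omega]
    have hr : ∑ j ∈ Finset.range (M + 1), M.choose (j + 1) • (c ^ j * a ^ (M - j))
        = a * ∑ j ∈ Finset.range M, M.choose (j + 1) • (c ^ j * a ^ (M - 1 - j)) := by
      rw [Finset.sum_range_succ, Nat.choose_succ_self, zero_smul, add_zero, Finset.mul_sum]
      refine Finset.sum_congr rfl fun j hj => ?_
      have hj := Finset.mem_range.mp hj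
      rw [mul_smul_comm, ← mul_assoc, (h.pow_right j).eq, mul_assoc, ← pow_succ',
        show M - 1 - j + 1 = M - j by omega]
    have hb : (a + c) ^ M = ∑ j ∈ Finset.range (M + 1), M.choose j • (c ^ j * a ^ (M - j)) := by
      rw [add_comm, h.symm.add_pow]
      simp only [nsmul_eq_mul, (Nat.cast_commute _ _).eq]
    simp only [Nat.add_sub_cancel, Nat.choose_succ_succ' M, add_smul, Finset.sum_add_distrib]
    rw [Finset.sum_range_succ, Nat.sub_self, pow_zero, one_mul, hl, ih, hr, hb, add_comm]

/-- Derivation identity underlying Lemma 2.10 (total-derivative form of the `W_∞` OPE residue):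
for `m ≥ 2`, `n ≥ 1` and all `x, y`,
`∑_{i=0}^{m−2} (−1)^i (d^{m+n−3−i} x) ⋆ (d^i y)
  = ∑_{k=1}^{m−1} binom(m−1,k) (−1)^{k−1} d^{k−1}((d^{m+n−2−k} x) ⋆ y)`. -/
theorem total_derivative_identity
    {A : Type*} [AddCommGroup A]
    (mul : A → A → A)
    (hmul_left : ∀ x y z : A, mul (x + y) z = mul x z + mul y z)
    (hmul_right : ∀ x y z : A, mul x (y + z) = mul x y + mul x z)
    (d : A → A)
    (hd_add : ∀ x y : A, d (x + y) = d x + d y)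
    (hleibniz : ∀ x y : A, d (mul x y) = mul (d x) y + mul x (d y)) :
    ∀ (m n : ℕ), 2 ≤ m → 1 ≤ n → ∀ x y : A,
      ∑ i ∈ Finset.range (m - 1),
          ((-1 : ℤ) ^ i) • mul (d^[m + n - 3 - i] x) (d^[i] y)
        = ∑ k ∈ Finset.Icc 1 (m - 1),
            (((Nat.choose (m - 1) k : ℤ)) * (-1 : ℤ) ^ (k - 1)) •
              d^[k - 1] (mul (d^[m + n - 2 - k] x) y) := by
  intro m n hm hn x y
  obtain ⟨M, rfl⟩ : ∃ M, m = M + 1 := ⟨m - 1, by omega⟩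
  obtain ⟨N, rfl⟩ : ∃ N, n = N + 1 := ⟨n - 1, by omega⟩
  -- Operators on binary maps: `a` applies `d` to the first argument, `D` to the value.
  let a : Module.End ℤ (A → A → A) := LinearMap.funLeft ℤ (A → A) d
  let D : Module.End ℤ (A → A → A) :=
    ((AddMonoidHom.mk' d hd_add).toIntLinearMap.compLeft A).compLeft A
  have ha (k : ℕ) (f : A → A → A) (u v : A) : (a ^ k) f u v = f (d^[k] u) v := by
    induction k generalizing u with
    | zero => rfl
    | succ k ih =>
      rw [pow_succ', Module.End.mul_apply, Function.iterate_succ_apply]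
      exact ih (d u)
  have hD (k : ℕ) (f : A → A → A) (u v : A) : (D ^ k) f u v = d^[k] (f u v) := by
    induction k with
    | zero => rfl
    | succ k ih =>
      rw [pow_succ', Module.End.mul_apply, Function.iterate_succ_apply', ← ih]
      rfl
  have hnegD (k : ℕ) (f : A → A → A) (u v : A) :
      ((-D) ^ k) f u v = (-1 : ℤ) ^ k • d^[k] (f u v) := by
    rw [← neg_one_zsmul D, smul_pow, LinearMap.smul_apply, Pi.smul_apply, Pi.smul_apply, hD]
  have hb (k : ℕ) (u v : A) : ((a + -D) ^ k) mul u v = (-1 : ℤ) ^ k • mul u (d^[k] v) := by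
    induction k generalizing u v with
    | zero => simp
    | succ k ih =>
      have hstep (f : A → A → A) : (a + -D) f u v = f (d u) v - d (f u v) :=
        (sub_eq_add_neg _ _).symm
      have hd_smul (z : ℤ) (w : A) : d (z • w) = z • d w :=
        map_zsmul (AddMonoidHom.mk' d hd_add) z w
      rw [pow_succ', Module.End.mul_apply, hstep, ih, ih, hd_smul, hleibniz,
        Function.iterate_succ_apply', pow_succ, mul_neg_one, neg_smul, smul_add]
      abel
  have hcomm : Commute a (-D) := Commute.neg_right rfl
  have key := congrFun₂ (LinearMap.congr_fun (hcomm.sum_pow_mul_add_pow M) mul) (d^[N] x) y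
  simp only [LinearMap.sum_apply, Finset.sum_apply, LinearMap.smul_apply, Pi.smul_apply,
    Module.End.mul_apply, ha, hb, hnegD] at key
  rw [Nat.add_sub_cancel, ← Finset.Ico_add_one_right_eq_Icc, Finset.sum_Ico_eq_sum_range,
    Nat.add_sub_cancel]
  convert key using 1 <;> refine Finset.sum_congr rfl fun i hi => ?_ <;>
    have hi := Finset.mem_range.mp hi
  · rw [← Function.iterate_add_apply,
      show M + 1 + (N + 1) - 3 - i = M - 1 - i + N by omega]
  · rw [← Function.iterate_add_apply, add_comm 1 i, Nat.add_sub_cancel, mul_smul, natCast_zsmul,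
      show M + 1 + (N + 1) - 2 - (i + 1) = M - 1 - i + N by omega]
end

section
/- Heat-type equation for the modified zeta function: for every τ ∈ ℍ and every z ∈ ℂ with z ∉ Λ_τ, one has 2πi · ∂_τ ζ(z; τ) = −ζ(z; τ) · P(z; τ) − (1/2) · P′(z; τ). -/
open Complex

/-- The lattice `Λ_τ = ℤ + ℤτ ⊆ ℂ`. -/
def latticeSet (τ : ℂ) : Set ℂ := {z | ∃ m n : ℤ, z = (m : ℂ) + (n : ℂ) * τ}

/-- The Weierstrass `℘`-function `℘(z;τ) = 1/z² + ∑_{ω ∈ Λ_τ∖{0}} (1/(z−ω)² − 1/ω²)`,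
with the lattice parametrized by `(m,n) ∈ ℤ × ℤ`. -/
noncomputable def wp (τ z : ℂ) : ℂ :=
  1 / z ^ 2 + ∑' q : ℤ × ℤ, if q = 0 then 0 else
    (1 / (z - ((q.1 : ℂ) + (q.2 : ℂ) * τ)) ^ 2 - 1 / ((q.1 : ℂ) + (q.2 : ℂ) * τ) ^ 2)

/-- The Weierstrass zeta function
`ζ_W(z;τ) = 1/z + ∑_{ω ∈ Λ_τ∖{0}} (1/(z−ω) + 1/ω + z/ω²)`. -/
noncomputable def wzeta (τ z : ℂ) : ℂ :=
  1 / z + ∑' q : ℤ × ℤ, if q = 0 then 0 else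
    (1 / (z - ((q.1 : ℂ) + (q.2 : ℂ) * τ)) + 1 / ((q.1 : ℂ) + (q.2 : ℂ) * τ)
      + z / ((q.1 : ℂ) + (q.2 : ℂ) * τ) ^ 2)

/-- The weight-two Eisenstein series `E₂(τ) = 1 − 24 ∑_{n≥1} σ₁(n) e^{2πinτ}`. -/
noncomputable def eisensteinE2 (τ : ℂ) : ℂ :=
  1 - 24 * ∑' n : ℕ,
    ((ArithmeticFunction.sigma 1 (n + 1) : ℕ) : ℂ) *
      Complex.exp (2 * Real.pi * Complex.I * ((n : ℂ) + 1) * τ)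

/-- The modified Weierstrass function (propagator) `P(z;τ) = ℘(z;τ) + (π²/3)E₂(τ)`. -/
noncomputable def Pfun (τ z : ℂ) : ℂ := wp τ z + ((Real.pi : ℂ) ^ 2 / 3) * eisensteinE2 τ

/-- The modified Weierstrass zeta function `ζ(z;τ) = ζ_W(z;τ) − (π²/3)E₂(τ)·z`. -/
noncomputable def zetafun (τ z : ℂ) : ℂ := wzeta τ z - ((Real.pi : ℂ) ^ 2 / 3) * eisensteinE2 τ * z

open Filter Topology Set

/-- The function `w ↦ π cot(πw)`. -/
noncomputable def cotPi (w : ℂ) : ℂ := Real.pi * cot (Real.pi * w)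

/-- The function `w ↦ π / sin(πw)`. -/
noncomputable def cscPi (w : ℂ) : ℂ := Real.pi / sin (Real.pi * w)

lemma ofReal_pi_ne_zero : (Real.pi : ℂ) ≠ 0 := ofReal_ne_zero.mpr Real.pi_ne_zero

@[simp] lemma cotPi_zero : cotPi 0 = 0 := by simp [cotPi, cot]

@[simp] lemma cscPi_zero : cscPi 0 = 0 := by simp [cscPi]

@[simp] lemma cotPi_neg (w : ℂ) : cotPi (-w) = -cotPi w := by
  simp [cotPi, cot, div_neg]

@[simp] lemma cscPi_neg (w : ℂ) : cscPi (-w) = -cscPi w := by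
  simp [cscPi, div_neg]

lemma sin_pi_mul_ne_zero_of_im_ne_zero {w : ℂ} (hw : w.im ≠ 0) : sin (Real.pi * w) ≠ 0 := by
  refine sin_pi_mul_ne_zero ?_
  rintro ⟨n, rfl⟩
  simp at hw

lemma cotPi_sub_add_cotPi {a b : ℂ} (h : sin (Real.pi * (a - b)) ≠ 0)
    (hb : sin (Real.pi * b) ≠ 0) :
    cotPi (a - b) + cotPi b = cscPi (a - b) * cscPi b * (sin (Real.pi * a) / Real.pi) := by
  have hs : sin (Real.pi * a) = sin (Real.pi * (a - b)) * cos (Real.pi * b) +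
      cos (Real.pi * (a - b)) * sin (Real.pi * b) := by
    rw [← sin_add]
    ring_nf
  have := ofReal_pi_ne_zero
  rw [hs, cotPi, cotPi, cscPi, cscPi, cot, cot]
  field_simp
  ring

lemma hasDerivAt_cotPi {w : ℂ} (hw : sin (Real.pi * w) ≠ 0) :
    HasDerivAt cotPi (-cscPi w ^ 2) w := by
  have h : HasDerivAt (fun x : ℂ => (Real.pi : ℂ) * x) Real.pi w := by
    simpa using (hasDerivAt_id w).const_mul (Real.pi : ℂ)
  refine ((((hasDerivAt_cos _).comp w h).div ((hasDerivAt_sin _).comp w h) hw).const_mul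
    (Real.pi : ℂ)).congr_deriv ?_
  have := sin_sq_add_cos_sq (Real.pi * w)
  simp only [cscPi, Function.comp_apply]
  field_simp
  linear_combination -this

lemma hasDerivAt_cscPi {w : ℂ} (hw : sin (Real.pi * w) ≠ 0) :
    HasDerivAt cscPi (-(cotPi w * cscPi w)) w := by
  have h : HasDerivAt (fun x : ℂ => (Real.pi : ℂ) * x) Real.pi w := by
    simpa using (hasDerivAt_id w).const_mul (Real.pi : ℂ)
  refine (((hasDerivAt_const w (Real.pi : ℂ)).div ((hasDerivAt_sin _).comp w h) hw)).congr_deriv ?_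
  simp only [cscPi, cotPi, cot, Function.comp_apply]
  field_simp
  ring

lemma norm_cscPi_le {w : ℂ} (hw : 1 ≤ |w.im|) :
    ‖cscPi w‖ ≤ 4 * Real.pi * Real.exp (-(Real.pi * |w.im|)) := by
  have hpi := Real.pi_pos
  have key : Real.exp (Real.pi * |w.im|) / 4 ≤ ‖sin (Real.pi * w)‖ := by
    have h1 : |‖cexp (-(Real.pi * w) * I)‖ - ‖cexp (Real.pi * w * I)‖| ≤
        2 * ‖sin (Real.pi * w)‖ := by
      refine (abs_norm_sub_norm_le _ _).trans (le_of_eq ?_)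
      rw [sin, norm_div, norm_mul]
      simp
      ring
    have e1 : ‖cexp (-(Real.pi * w) * I)‖ = Real.exp (Real.pi * w.im) := by
      rw [norm_exp]; simp
    have e2 : ‖cexp (Real.pi * w * I)‖ = Real.exp (-(Real.pi * w.im)) := by
      rw [norm_exp]; simp
    rw [e1, e2] at h1
    have h2 : Real.exp (Real.pi * |w.im|) - Real.exp (-(Real.pi * |w.im|)) ≤
        |Real.exp (Real.pi * w.im) - Real.exp (-(Real.pi * w.im))| := by
      rcases abs_cases w.im with ⟨h, -⟩ | ⟨h, -⟩
      · rw [h]; exact le_abs_self _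
      · rw [h, abs_sub_comm]
        simpa using le_abs_self (Real.exp (-(Real.pi * w.im)) - Real.exp (Real.pi * w.im))
    have h3 : 3 ≤ Real.exp (Real.pi * |w.im|) := by
      have := Real.add_one_le_exp (Real.pi * |w.im|)
      have := Real.pi_gt_three
      nlinarith
    have h4 : Real.exp (-(Real.pi * |w.im|)) ≤ 1 := by
      rw [Real.exp_le_one_iff]
      nlinarith
    linarith
  have he := Real.exp_pos (Real.pi * |w.im|)
  rw [cscPi, norm_div, norm_real, Real.norm_of_nonneg hpi.le, Real.exp_neg,
    div_le_iff₀ (by linarith)]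
  calc Real.pi = 4 * Real.pi * (Real.exp (Real.pi * |w.im|))⁻¹ *
      (Real.exp (Real.pi * |w.im|) / 4) := by field_simp
    _ ≤ _ := by gcongr

lemma norm_cotPi_add_le {w : ℂ} (hw : 0 < w.im) : ‖cotPi w + Real.pi * I‖ ≤ ‖cscPi w‖ := by
  have hs := sin_pi_mul_ne_zero_of_im_ne_zero hw.ne'
  have h : cotPi w + Real.pi * I = cexp (Real.pi * w * I) * cscPi w := by
    rw [exp_mul_I, cotPi, cscPi, cot]
    field_simp
  rw [h, norm_mul]
  refine mul_le_of_le_one_left (norm_nonneg _) ?_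
  rw [norm_exp, Real.exp_le_one_iff]
  simp
  positivity

lemma summable_natAbs_mul_pow_natAbs {r : ℝ} (h0 : 0 ≤ r) (h1 : r < 1) (k : ℕ) :
    Summable fun m : ℤ => (m.natAbs : ℝ) ^ k * r ^ m.natAbs := by
  have h := summable_pow_mul_geometric_of_norm_lt_one k (r := r)
    (by rwa [Real.norm_of_nonneg h0])
  exact Summable.of_nat_of_neg (by simpa using h) (by simpa using h)

lemma summable_pow_natAbs {r : ℝ} (h0 : 0 ≤ r) (h1 : r < 1) :
    Summable fun m : ℤ => r ^ m.natAbs := by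
  simpa using summable_natAbs_mul_pow_natAbs h0 h1 0

lemma eventually_cofinite_le_abs_intCast (C : ℝ) : ∀ᶠ m : ℤ in cofinite, C ≤ |(m : ℝ)| := by
  rw [Int.cofinite_eq]
  exact eventually_sup.mpr
    ⟨(tendsto_abs_atBot_atTop.comp
        (tendsto_intCast_atBot_iff.mpr tendsto_id)).eventually_ge_atTop _,
      (tendsto_abs_atTop_atTop.comp tendsto_intCast_atTop_atTop).eventually_ge_atTop _⟩

lemma abs_intCast_mul_sub_le_abs_im {R δ : ℝ} {z τ : ℂ} (m : ℤ) (hδ : 0 < δ) (hz : ‖z‖ ≤ R)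
    (hτ : δ ≤ τ.im) : |(m : ℝ)| * δ - R ≤ |(z - m * τ).im| := by
  have h1 : (z - m * τ).im = z.im - m * τ.im := by simp
  have h2 : |(m : ℝ)| * δ ≤ |(m : ℝ) * τ.im| := by
    rw [abs_mul, abs_of_pos (hδ.trans_le hτ)]
    gcongr
  have h3 := abs_sub_abs_le_abs_sub ((m : ℝ) * τ.im) z.im
  have h4 := (abs_im_le_norm z).trans hz
  rw [h1, abs_sub_comm]
  linarith

lemma eventually_norm_cscPi_sub_le (R : ℝ) {δ : ℝ} (hδ : 0 < δ) :
    ∀ᶠ m : ℤ in cofinite, ∀ z τ : ℂ, ‖z‖ ≤ R → δ ≤ τ.im →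
      ‖cscPi (z - m * τ)‖ ≤
        4 * Real.pi * Real.exp (Real.pi * R) * Real.exp (-(Real.pi * δ)) ^ m.natAbs := by
  filter_upwards [eventually_cofinite_le_abs_intCast ((R + 1) / δ)] with m hm z τ hz hτ
  rw [div_le_iff₀ hδ] at hm
  have him := abs_intCast_mul_sub_le_abs_im m hδ hz hτ
  refine (norm_cscPi_le (by linarith)).trans ?_
  rw [mul_assoc (4 * Real.pi), ← Real.exp_nat_mul, ← Real.exp_add]
  gcongr
  have : (m.natAbs : ℝ) = |(m : ℝ)| := by simp
  rw [this]
  nlinarith [Real.pi_pos]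

lemma summable_norm_cscPi_sub (z : ℂ) {τ : ℂ} (hτ : 0 < τ.im) :
    Summable fun m : ℤ => ‖cscPi (z - m * τ)‖ := by
  have hr : Real.exp (-(Real.pi * τ.im)) < 1 := by
    rw [Real.exp_lt_one_iff]
    have := Real.pi_pos
    nlinarith
  refine Summable.of_norm_bounded_eventually
    ((summable_pow_natAbs (Real.exp_pos _).le hr).mul_left
      (4 * Real.pi * Real.exp (Real.pi * ‖z‖))) ?_
  filter_upwards [eventually_norm_cscPi_sub_le ‖z‖ hτ] with m hm
  simpa using hm z τ le_rfl le_rfl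

/-- Term-by-term differentiation of a series whose terms are bounded near the point, for all but
finitely many indices, by a summable family. -/
lemma hasSum_deriv_of_eventually_norm_le {ι : Type*} {F : ι → ℂ → ℂ} {v : ι → ℝ} {x : ℂ}
    {U : Set ℂ} (hU : U ∈ 𝓝 x) (hF : ∀ i, DifferentiableOn ℂ (F i) U) (hv : Summable v)
    (hle : ∀ᶠ i in cofinite, ∀ w ∈ U, ‖F i w‖ ≤ v i) :
    HasSum (fun i => deriv (F i) x) (deriv (fun w => ∑' i, F i w) x) := by
  obtain ⟨ε, hε, hεU⟩ := Metric.nhds_basis_closedBall.mem_iff.mp hU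
  have hb (i : ι) : ∃ C, ∀ w ∈ Metric.closedBall x ε, ‖F i w‖ ≤ C :=
    (isCompact_closedBall x ε).exists_bound_of_continuousOn ((hF i).continuousOn.mono hεU)
  choose C hC using hb
  classical
  let u : ι → ℝ := fun i => if ∀ w ∈ U, ‖F i w‖ ≤ v i then v i else C i
  have hu : Summable u := by
    refine (summable_congr_cofinite ?_).mpr hv
    filter_upwards [hle] with i hi
    exact if_pos hi
  have hsub := Metric.ball_subset_closedBall.trans hεU
  refine hasSum_deriv_of_summable_norm hu (fun i => (hF i).mono hsub) Metric.isOpen_ball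
    (fun i w hw => ?_) (Metric.mem_ball_self hε)
  by_cases h : ∀ w ∈ U, ‖F i w‖ ≤ v i
  · simpa only [u, if_pos h] using h w (hsub hw)
  · simpa only [u, if_neg h] using hC i w (Metric.ball_subset_closedBall hw)

lemma sub_intCast_ne_zero_of_sin_pi_mul_ne_zero {a : ℂ} (ha : sin (Real.pi * a) ≠ 0) (m : ℤ) :
    a - m ≠ 0 := by
  intro h
  rw [sub_eq_zero.mp h, mul_comm, sin_int_mul_pi] at ha
  exact ha rfl

lemma hasSum_one_div_sub_add_one_div {a : ℂ} (ha : sin (Real.pi * a) ≠ 0) :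
    HasSum (fun m : ℤ => 1 / (a - m) + 1 / (m : ℂ)) (cotPi a) := by
  have hne := sub_intCast_ne_zero_of_sin_pi_mul_ne_zero ha
  have hsum : Summable (fun m : ℤ => 1 / (a - m) + 1 / (m : ℂ)) := by
    refine (summable_congr_cofinite ?_).mpr
      ((EisensteinSeries.summable_linear_sub_mul_linear_add a 1 0).mul_left a)
    filter_upwards [(Set.finite_singleton (0 : ℤ)).compl_mem_cofinite] with m hm
    have hm' : (m : ℂ) ≠ 0 := Int.cast_ne_zero.mpr hm
    have := hne m
    simp only [Int.cast_one, one_mul, Int.cast_zero, zero_mul, zero_add]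
    field_simp
    ring
  have hmem : a ∈ integerComplement := by
    rintro ⟨n, rfl⟩
    exact hne n (sub_self _)
  have hp := tsum_int_eq_zero_add_tsum_pnat hsum
  have hs1 : Summable fun n : ℕ+ => 1 / (a - ((n : ℤ) : ℂ)) + 1 / (((n : ℤ)) : ℂ) :=
    hsum.comp_injective (i := fun n : ℕ+ => ((n : ℕ) : ℤ))
      (fun x y h => by simpa using h)
  have hs2 : Summable fun n : ℕ+ => 1 / (a - ((-n : ℤ) : ℂ)) + 1 / (((-n : ℤ)) : ℂ) :=
    hsum.comp_injective (i := fun n : ℕ+ => -((n : ℕ) : ℤ))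
      (fun x y h => by simpa using h)
  rw [hsum.hasSum_iff, hp, add_assoc, ← hs1.tsum_add hs2, cotPi, cot_series_rep hmem]
  simp [div_eq_mul_inv]
  refine tsum_congr fun n => ?_
  ring

lemma hasSum_one_div_sub_sq {a : ℂ} (ha : sin (Real.pi * a) ≠ 0) :
    HasSum (fun m : ℤ => 1 / (a - m) ^ 2) (cscPi a ^ 2) := by
  have hopen : IsOpen {w : ℂ | sin (Real.pi * w) ≠ 0} := isOpen_ne_fun (by fun_prop) (by fun_prop)
  have hU : {w : ℂ | sin (Real.pi * w) ≠ 0} ∩ Metric.ball a 1 ∈ 𝓝 a :=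
    inter_mem (hopen.mem_nhds ha) (Metric.ball_mem_nhds a one_pos)
  have hd {w : ℂ} (hw : sin (Real.pi * w) ≠ 0) (m : ℤ) :
      HasDerivAt (fun w : ℂ => 1 / (w - m) + 1 / (m : ℂ)) (-(1 / (w - m) ^ 2)) w := by
    have hne := sub_intCast_ne_zero_of_sin_pi_mul_ne_zero hw m
    have := (((hasDerivAt_id w).sub_const (m : ℂ)).fun_inv hne).add_const (1 / (m : ℂ))
    simpa [neg_div] using this
  have h := hasSum_deriv_of_eventually_norm_le (ι := ℤ)
    (F := fun m w => 1 / (w - m) + 1 / (m : ℂ))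
    (v := fun m => 2 * (‖a‖ + 1) * (1 / (m : ℝ) ^ 2)) hU
    (fun m w hw => (hd hw.1 m).differentiableAt.differentiableWithinAt)
    ((Real.summable_one_div_int_pow.mpr one_lt_two).mul_left _) ?_
  · have hderiv : deriv (fun w => ∑' m : ℤ, (1 / (w - m) + 1 / (m : ℂ))) a = -cscPi a ^ 2 := by
      have : (fun w => ∑' m : ℤ, (1 / (w - m) + 1 / (m : ℂ))) =ᶠ[𝓝 a] cotPi := by
        filter_upwards [hopen.mem_nhds ha] with w hw
        exact (hasSum_one_div_sub_add_one_div hw).tsum_eq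
      rw [this.deriv_eq, (hasDerivAt_cotPi ha).deriv]
    rw [hderiv] at h
    simp only [(hd ha _).deriv] at h
    simpa using h.neg
  · filter_upwards [eventually_cofinite_le_abs_intCast (2 * (‖a‖ + 1))] with m hm w hw
    have hne := sub_intCast_ne_zero_of_sin_pi_mul_ne_zero hw.1 m
    have hm0 : 0 < |(m : ℝ)| := by linarith [norm_nonneg a]
    have hm' : (m : ℂ) ≠ 0 := by
      rintro h
      simp [Int.cast_eq_zero.mp h] at hm0
    have hwn : ‖w‖ ≤ ‖a‖ + 1 := by
      have := mem_ball_iff_norm.mp hw.2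
      have := norm_sub_norm_le w a
      linarith
    have hnm : ‖(m : ℂ)‖ = |(m : ℝ)| := by simp
    have hlow : |(m : ℝ)| / 2 ≤ ‖w - m‖ := by
      have := norm_sub_norm_le (m : ℂ) w
      rw [norm_sub_rev, hnm] at this
      linarith
    have e : 1 / (w - m) + 1 / (m : ℂ) = w / (m * (w - m)) := by
      field_simp
      ring
    rw [e, norm_div, norm_mul, hnm, ← sq_abs (m : ℝ)]
    calc ‖w‖ / (|(m : ℝ)| * ‖w - m‖) ≤ (‖a‖ + 1) / (|(m : ℝ)| * (|(m : ℝ)| / 2)) := by gcongr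
      _ = _ := by field_simp

lemma summable_lattice_inv_cube {τ : ℂ} (hτ : 0 < τ.im) :
    Summable fun q : ℤ × ℤ => (((q.1 : ℂ) + q.2 * τ) ^ 3)⁻¹ := by
  have h := summable_prod_eisSummand (k := 3) le_rfl ⟨τ, hτ⟩
  refine ((Equiv.prodComm ℤ ℤ).summable_iff.mpr h).congr fun q => ?_
  simp only [Function.comp_apply, EisensteinSeries.eisSummand]
  simp [add_comm]

lemma eventually_le_norm_lattice {τ : ℂ} (hτ : 0 < τ.im) {R : ℝ} (hR : 0 < R) :
    ∀ᶠ q : ℤ × ℤ in cofinite, R ≤ ‖(q.1 : ℂ) + q.2 * τ‖ := by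
  have h := (summable_lattice_inv_cube hτ).norm.tendsto_cofinite_zero
  have h0 : (0 : ℝ) < (R ^ 3)⁻¹ := by positivity
  filter_upwards [h.eventually_lt_const h0,
    (Set.finite_singleton (0 : ℤ × ℤ)).compl_mem_cofinite] with q hq hq0
  have hne : (q.1 : ℂ) + q.2 * τ ≠ 0 := by
    intro h
    have him := congrArg im h
    simp [hτ.ne'] at him
    rw [him] at h
    simp at h
    exact hq0 (Prod.ext h him)
  have := norm_pos_iff.mpr hne
  rw [norm_inv, norm_pow, inv_lt_inv₀ (by positivity) (by positivity)] at hq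
  exact (lt_of_pow_lt_pow_left₀ 3 this.le hq).le

lemma norm_wzeta_summand_le {z ω : ℂ} (hω : 0 < ‖ω‖) (h : 2 * ‖z‖ ≤ ‖ω‖) :
    ‖1 / (z - ω) + 1 / ω + z / ω ^ 2‖ ≤ 2 * ‖z‖ ^ 2 * ‖(ω ^ 3)⁻¹‖ := by
  have hlow : ‖ω‖ / 2 ≤ ‖z - ω‖ := by
    have := norm_sub_norm_le ω z
    rw [norm_sub_rev] at this
    linarith
  have h1 : ω ≠ 0 := norm_pos_iff.mp hω
  have h2 : z - ω ≠ 0 := norm_pos_iff.mp (by linarith)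
  have e : 1 / (z - ω) + 1 / ω + z / ω ^ 2 = z ^ 2 / (ω ^ 2 * (z - ω)) := by
    field_simp
    ring
  rw [e, norm_div, norm_mul, norm_inv, norm_pow, norm_pow, norm_pow]
  calc ‖z‖ ^ 2 / (‖ω‖ ^ 2 * ‖z - ω‖) ≤ ‖z‖ ^ 2 / (‖ω‖ ^ 2 * (‖ω‖ / 2)) := by gcongr
    _ = _ := by field_simp

lemma summable_wzeta_summand (z : ℂ) {τ : ℂ} (hτ : 0 < τ.im) :
    Summable fun q : ℤ × ℤ => 1 / (z - ((q.1 : ℂ) + q.2 * τ)) + 1 / ((q.1 : ℂ) + q.2 * τ) +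
      z / ((q.1 : ℂ) + q.2 * τ) ^ 2 := by
  refine Summable.of_norm_bounded_eventually
    ((summable_lattice_inv_cube hτ).norm.mul_left (2 * ‖z‖ ^ 2)) ?_
  filter_upwards [eventually_le_norm_lattice hτ (R := 2 * ‖z‖ + 1) (by positivity)] with q hq
  exact norm_wzeta_summand_le (by linarith [norm_nonneg z]) (by linarith)

lemma summable_wp_summand (z : ℂ) {τ : ℂ} (hτ : 0 < τ.im) :
    Summable fun q : ℤ × ℤ => 1 / (z - ((q.1 : ℂ) + q.2 * τ)) ^ 2 -
      1 / ((q.1 : ℂ) + q.2 * τ) ^ 2 := by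
  refine Summable.of_norm_bounded_eventually
    ((summable_lattice_inv_cube hτ).norm.mul_left (10 * (‖z‖ + 1))) ?_
  filter_upwards [eventually_le_norm_lattice hτ (R := 2 * (‖z‖ + 1)) (by positivity)] with q hq
  refine (PeriodPair.weierstrassP_bound (‖z‖ + 1) (by positivity) z (by linarith) _ hq).trans
    (le_of_eq ?_)
  rw [norm_inv, norm_pow, Real.rpow_neg (norm_nonneg _)]
  norm_cast

lemma wzeta_eq_tsum (z : ℂ) {τ : ℂ} (hτ : 0 < τ.im) :
    wzeta τ z = ∑' q : ℤ × ℤ, (1 / (z - ((q.1 : ℂ) + q.2 * τ)) + 1 / ((q.1 : ℂ) + q.2 * τ) +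
      z / ((q.1 : ℂ) + q.2 * τ) ^ 2) := by
  rw [(summable_wzeta_summand z hτ).tsum_eq_add_tsum_ite 0, wzeta]
  simp

lemma wp_eq_tsum (z : ℂ) {τ : ℂ} (hτ : 0 < τ.im) :
    wp τ z = ∑' q : ℤ × ℤ, (1 / (z - ((q.1 : ℂ) + q.2 * τ)) ^ 2 -
      1 / ((q.1 : ℂ) + q.2 * τ) ^ 2) := by
  rw [(summable_wp_summand z hτ).tsum_eq_add_tsum_ite 0, wp]
  simp

/-- The row sum `∑ₘ (m + nτ)⁻²`, where the term at the origin is omitted. -/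
noncomputable def rowSum (τ : ℂ) (n : ℤ) : ℂ := ∑' m : ℤ, 1 / ((m : ℂ) + n * τ) ^ 2

lemma hasSum_rowSum (τ : ℂ) (n : ℤ) :
    HasSum (fun m : ℤ => 1 / ((m : ℂ) + n * τ) ^ 2) (rowSum τ n) := by
  refine Summable.hasSum ((EisensteinSeries.linear_right_summable τ n (k := 2) le_rfl).congr
    fun m => ?_)
  rw [add_comm, one_div]
  norm_cast

lemma rowSum_eq_cscPi_sq {τ : ℂ} (hτ : 0 < τ.im) {n : ℤ} (hn : n ≠ 0) :
    rowSum τ n = cscPi (n * τ) ^ 2 := by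
  have hs : sin (Real.pi * -(n * τ)) ≠ 0 :=
    sin_pi_mul_ne_zero_of_im_ne_zero (by simp [hn, hτ.ne'])
  have h := hasSum_one_div_sub_sq hs
  rw [cscPi_neg, neg_sq] at h
  refine (hasSum_rowSum τ n).unique ?_
  convert h using 3 with m
  ring

lemma summable_rowSum {τ : ℂ} (hτ : 0 < τ.im) : Summable (rowSum τ) := by
  have h := summable_norm_cscPi_sub 0 hτ
  have h2 : Summable fun n : ℤ => cscPi (n * τ) ^ 2 := by
    refine Summable.of_norm_bounded_eventually h ?_
    filter_upwards [h.tendsto_cofinite_zero.eventually_le_const zero_lt_one] with n hn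
    simp only [zero_sub, cscPi_neg, norm_neg] at hn ⊢
    rw [norm_pow]
    exact pow_le_of_le_one (norm_nonneg _) hn two_ne_zero
  refine (summable_congr_cofinite ?_).mpr h2
  filter_upwards [(Set.finite_singleton (0 : ℤ)).compl_mem_cofinite] with n hn
  exact rowSum_eq_cscPi_sq hτ hn

lemma tsum_rowSum {τ : ℂ} (hτ : 0 < τ.im) :
    ∑' n, rowSum τ n = ((Real.pi : ℂ) ^ 2 / 3) * eisensteinE2 τ := by
  have h := EisensteinSeries.hasSum_e2Summand_symmetricIcc ⟨τ, hτ⟩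
  have he (n : ℤ) : EisensteinSeries.e2Summand n ⟨τ, hτ⟩ = rowSum τ n := by
    refine tsum_congr fun m => ?_
    simp only [EisensteinSeries.eisSummand]
    simp [add_comm]
  simp only [he] at h
  have h' : HasSum (rowSum τ) (∑' n, rowSum τ n) (SummationFilter.symmetricIcc ℤ) :=
    (summable_rowSum hτ).hasSum.mono_left SummationFilter.LeAtTop.le_atTop
  rw [h'.unique h, riemannZeta_two, eisensteinE2,
    tsum_pnat_eq_tsum_succ (f := fun n : ℕ => (ArithmeticFunction.sigma 1 n : ℂ) *
      cexp (2 * Real.pi * I * τ) ^ n)]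
  have hexp (n : ℕ) : cexp (2 * Real.pi * I * τ) ^ (n + 1) =
      cexp (2 * Real.pi * I * ((n : ℂ) + 1) * τ) := by
    rw [← Complex.exp_nat_mul]
    push_cast
    ring_nf
  simp only [hexp]
  ring

lemma notMem_latticeSet_iff {τ z : ℂ} :
    z ∉ latticeSet τ ↔ ∀ n : ℤ, sin (Real.pi * (z - n * τ)) ≠ 0 := by
  constructor
  · intro hz n
    refine sin_pi_mul_ne_zero ?_
    rintro ⟨m, hm⟩
    exact hz ⟨m, n, by rw [hm]; ring⟩
  · rintro h ⟨m, n, rfl⟩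
    apply h n
    rw [add_sub_cancel_right, mul_comm, sin_int_mul_pi]

lemma sub_intCast_mul_notMem_latticeSet {τ z : ℂ} (hz : z ∉ latticeSet τ) (n : ℤ) :
    z - n * τ ∉ latticeSet τ := by
  rintro ⟨a, b, h⟩
  exact hz ⟨a, b + n, by push_cast; linear_combination h⟩

lemma sin_pi_mul_intCast_mul_ne_zero {τ : ℂ} (hτ : 0 < τ.im) {n : ℤ} (hn : n ≠ 0) :
    sin (Real.pi * (n * τ)) ≠ 0 :=
  sin_pi_mul_ne_zero_of_im_ne_zero (by simp [hn, hτ.ne'])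

lemma eventually_notMem_latticeSet {τ z : ℂ} (hτ : 0 < τ.im) (hz : z ∉ latticeSet τ) :
    ∀ᶠ p : ℂ × ℂ in 𝓝 (z, τ), p.1 ∉ latticeSet p.2 := by
  simp only [notMem_latticeSet_iff] at hz ⊢
  have hδ : 0 < τ.im / 2 := half_pos hτ
  have hfin := eventually_cofinite_le_abs_intCast ((‖z‖ + 2) / (τ.im / 2))
  rw [eventually_cofinite] at hfin
  have hcont : ContinuousAt (fun p : ℂ × ℂ => ‖p.1‖) (z, τ) := by fun_prop
  have hcont' : ContinuousAt (fun p : ℂ × ℂ => p.2.im) (z, τ) :=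
    (continuous_im.comp continuous_snd).continuousAt
  have hev (n : ℤ) : ∀ᶠ p : ℂ × ℂ in 𝓝 (z, τ), sin (Real.pi * (p.1 - n * p.2)) ≠ 0 := by
    have : ContinuousAt (fun p : ℂ × ℂ => sin (Real.pi * (p.1 - n * p.2))) (z, τ) := by fun_prop
    exact this.eventually_ne (hz n)
  filter_upwards [(eventually_all_finite hfin).mpr fun n _ => hev n,
    hcont.eventually_le_const (lt_add_one ‖z‖), hcont'.eventually_const_le (half_lt_self hτ)]
    with p hp hp1 hp2 n
  by_cases hn : (‖z‖ + 2) / (τ.im / 2) ≤ |(n : ℝ)|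
  · refine sin_pi_mul_ne_zero_of_im_ne_zero (abs_pos.mp ?_)
    rw [div_le_iff₀ hδ] at hn
    have := abs_intCast_mul_sub_le_abs_im n hδ hp1 hp2
    linarith
  · exact hp n hn

lemma hasSum_one_div_add_sub_one_div {τ : ℂ} (hτ : 0 < τ.im) (n : ℤ) :
    HasSum (fun m : ℤ => 1 / ((m : ℂ) + n * τ) - 1 / (m : ℂ)) (cotPi (n * τ)) := by
  rcases eq_or_ne n 0 with rfl | hn
  · simp [hasSum_zero]
  · have hs : sin (Real.pi * -(n * τ)) ≠ 0 :=
      sin_pi_mul_ne_zero_of_im_ne_zero (by simp [hn, hτ.ne'])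
    have h := (hasSum_one_div_sub_add_one_div hs).neg
    rw [cotPi_neg, neg_neg] at h
    refine h.congr_fun fun m => ?_
    rw [← neg_add', one_div_neg_eq_neg_one_div, add_comm (n * τ) (m : ℂ)]
    ring

lemma hasSum_zetafun {τ z : ℂ} (hτ : 0 < τ.im) (hz : z ∉ latticeSet τ) :
    HasSum (fun n : ℤ => cotPi (z - n * τ) + cotPi (n * τ)) (zetafun τ z) := by
  have hz' := notMem_latticeSet_iff.mp hz
  have h := (summable_wzeta_summand z hτ).hasSum
  rw [← wzeta_eq_tsum z hτ, ← (Equiv.prodComm ℤ ℤ).hasSum_iff] at h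
  have hrow := h.prod_fiberwise
    (g := fun n : ℤ => cotPi (z - n * τ) + cotPi (n * τ) + z * rowSum τ n) fun n => by
      refine (((hasSum_one_div_sub_add_one_div (hz' n)).add
        (hasSum_one_div_add_sub_one_div hτ n)).add ((hasSum_rowSum τ n).mul_left z)).congr_fun
        fun m => ?_
      simp only [Function.comp_apply, Equiv.prodComm_apply, Prod.swap_prod_mk]
      rw [sub_add_eq_sub_sub_swap]
      ring
  have hE := (summable_rowSum hτ).hasSum.mul_left z
  rw [tsum_rowSum hτ] at hE
  rw [zetafun, mul_comm _ z]
  exact (hrow.sub hE).congr_fun fun n => by ring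

lemma hasSum_Pfun {τ z : ℂ} (hτ : 0 < τ.im) (hz : z ∉ latticeSet τ) :
    HasSum (fun n : ℤ => cscPi (z - n * τ) ^ 2) (Pfun τ z) := by
  have hz' := notMem_latticeSet_iff.mp hz
  have h := (summable_wp_summand z hτ).hasSum
  rw [← wp_eq_tsum z hτ, ← (Equiv.prodComm ℤ ℤ).hasSum_iff] at h
  have hrow := h.prod_fiberwise (g := fun n : ℤ => cscPi (z - n * τ) ^ 2 - rowSum τ n) fun n => by
    refine ((hasSum_one_div_sub_sq (hz' n)).sub (hasSum_rowSum τ n)).congr_fun fun m => ?_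
    simp only [Function.comp_apply, Equiv.prodComm_apply, Prod.swap_prod_mk]
    rw [sub_add_eq_sub_sub_swap]
  have hE := (summable_rowSum hτ).hasSum
  rw [tsum_rowSum hτ] at hE
  exact (hrow.add hE).congr_fun fun n => by ring

lemma exp_neg_pi_mul_lt_one {δ : ℝ} (hδ : 0 < δ) : Real.exp (-(Real.pi * δ)) < 1 := by
  rw [Real.exp_lt_one_iff, neg_lt_zero]
  exact mul_pos Real.pi_pos hδ

lemma hasSum_intCast_mul_cscPi_sq {τ : ℂ} (hτ : 0 < τ.im) :
    HasSum (fun m : ℤ => m * cscPi (m * τ) ^ 2) 0 := by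
  have hs : Summable fun m : ℤ => m * cscPi (m * τ) ^ 2 := by
    refine Summable.of_norm_bounded_eventually
      ((summable_natAbs_mul_pow_natAbs (Real.exp_pos _).le (exp_neg_pi_mul_lt_one hτ) 1).mul_left
        (4 * Real.pi)) ?_
    filter_upwards [eventually_norm_cscPi_sub_le 0 hτ,
      (summable_norm_cscPi_sub 0 hτ).tendsto_cofinite_zero.eventually_le_const zero_lt_one]
      with m hm hm1
    have hm := hm 0 τ (by simp) le_rfl
    simp only [zero_sub, cscPi_neg, norm_neg, mul_zero, Real.exp_zero, mul_one] at hm hm1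
    have hn : ‖(m : ℂ)‖ = (m.natAbs : ℝ) := by simp
    rw [norm_mul, norm_pow, hn, pow_one, mul_left_comm]
    gcongr
    exact (pow_le_of_le_one (norm_nonneg _) hm1 two_ne_zero).trans hm
  have h := hs.hasSum
  have hneg := (Equiv.neg ℤ).hasSum_iff.mpr h
  have hodd : ((fun m : ℤ => m * cscPi (m * τ) ^ 2) ∘ Equiv.neg ℤ) =
      fun m : ℤ => -(m * cscPi (m * τ) ^ 2) := by
    ext m
    simp
  rw [hodd] at hneg
  rwa [self_eq_neg.mp (hneg.unique h.neg)] at h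

lemma hasSum_deriv_zetafun {τ z : ℂ} (hτ : 0 < τ.im) (hz : z ∉ latticeSet τ) :
    HasSum (fun m : ℤ => m * cscPi (z - m * τ) ^ 2) (deriv (fun s => zetafun s z) τ) := by
  have hδ : 0 < τ.im / 2 := half_pos hτ
  have hU : {s : ℂ | z ∉ latticeSet s ∧ τ.im / 2 ≤ s.im} ∈ 𝓝 τ := by
    refine inter_mem ?_ (continuous_im.continuousAt.eventually_const_le (half_lt_self hτ))
    exact (Continuous.prodMk_right z).continuousAt.eventually (eventually_notMem_latticeSet hτ hz)
  have hτU : z ∉ latticeSet τ ∧ τ.im / 2 ≤ τ.im := ⟨hz, (half_lt_self hτ).le⟩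
  have hd {s : ℂ} (hs : z ∉ latticeSet s ∧ τ.im / 2 ≤ s.im) (m : ℤ) :
      HasDerivAt (fun s => cotPi (z - m * s) + cotPi (m * s))
        (m * cscPi (z - m * s) ^ 2 - m * cscPi (m * s) ^ 2) s := by
    rcases eq_or_ne m 0 with rfl | hm
    · simpa using hasDerivAt_const s (cotPi z)
    · have h1 : HasDerivAt (fun s : ℂ => (m : ℂ) * s) m s := by
        simpa using (hasDerivAt_id s).const_mul (m : ℂ)
      have h2 := (hasDerivAt_cotPi (notMem_latticeSet_iff.mp hs.1 m)).comp s (h1.const_sub z)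
      have h3 := (hasDerivAt_cotPi
        (sin_pi_mul_intCast_mul_ne_zero (hδ.trans_le hs.2) hm)).comp s h1
      exact (h2.add h3).congr_deriv (by ring)
  set K := 4 * Real.pi * Real.exp (Real.pi * ‖z‖)
  set r := Real.exp (-(Real.pi * (τ.im / 2)))
  have hr : r < 1 := exp_neg_pi_mul_lt_one hδ
  have h := hasSum_deriv_of_eventually_norm_le
    (F := fun (m : ℤ) s => cotPi (z - m * s) + cotPi (m * s))
    (v := fun m => K * K * ‖sin (Real.pi * z) / Real.pi‖ * r ^ m.natAbs) hU
    (fun m s hs => (hd hs m).differentiableAt.differentiableWithinAt)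
    ((summable_pow_natAbs (Real.exp_pos _).le hr).mul_left _) ?_
  · have hderiv : deriv (fun s => ∑' m : ℤ, (cotPi (z - m * s) + cotPi (m * s))) τ =
        deriv (fun s => zetafun s z) τ := by
      refine EventuallyEq.deriv_eq ?_
      filter_upwards [hU] with s hs
      exact (hasSum_zetafun (hδ.trans_le hs.2) hs.1).tsum_eq
    simp only [hderiv, (hd hτU _).deriv] at h
    simpa using h.add (hasSum_intCast_mul_cscPi_sq hτ)
  · filter_upwards [eventually_norm_cscPi_sub_le ‖z‖ hδ,
      (Set.finite_singleton (0 : ℤ)).compl_mem_cofinite] with m hm hm0 s hs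
    have h1 := hm z s le_rfl hs.2
    have h2 := hm 0 s (by simp) hs.2
    rw [zero_sub, cscPi_neg, norm_neg] at h2
    rw [cotPi_sub_add_cotPi (notMem_latticeSet_iff.mp hs.1 m)
      (sin_pi_mul_intCast_mul_ne_zero (hδ.trans_le hs.2) hm0), norm_mul, norm_mul]
    have hr1 : r ^ m.natAbs ≤ 1 := pow_le_one₀ (Real.exp_pos _).le hr.le
    have hK : 0 ≤ K := by positivity
    calc _ ≤ K * r ^ m.natAbs * (K * 1) * ‖sin (Real.pi * z) / Real.pi‖ := by
          gcongr
          exact h2.trans (by gcongr)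
      _ = _ := by ring

lemma hasSum_deriv_Pfun {τ z : ℂ} (hτ : 0 < τ.im) (hz : z ∉ latticeSet τ) :
    HasSum (fun m : ℤ => -2 * (cotPi (z - m * τ) * cscPi (z - m * τ) ^ 2))
      (deriv (Pfun τ) z) := by
  have hU : {w : ℂ | w ∉ latticeSet τ ∧ ‖w‖ ≤ ‖z‖ + 1} ∈ 𝓝 z := by
    refine inter_mem ?_ (continuous_norm.continuousAt.eventually_le_const (lt_add_one _))
    exact (Continuous.prodMk_left τ).continuousAt.eventually (eventually_notMem_latticeSet hτ hz)
  have hd {w : ℂ} (hw : w ∉ latticeSet τ) (m : ℤ) :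
      HasDerivAt (fun w => cscPi (w - m * τ) ^ 2)
        (-2 * (cotPi (w - m * τ) * cscPi (w - m * τ) ^ 2)) w := by
    have h := (hasDerivAt_cscPi (notMem_latticeSet_iff.mp hw m)).comp w
      ((hasDerivAt_id w).sub_const (m * τ))
    refine (h.pow 2).congr_deriv ?_
    simp
    ring
  set K := 4 * Real.pi * Real.exp (Real.pi * (‖z‖ + 1))
  set r := Real.exp (-(Real.pi * τ.im))
  have hr : r < 1 := exp_neg_pi_mul_lt_one hτ
  have h := hasSum_deriv_of_eventually_norm_le (F := fun (m : ℤ) w => cscPi (w - m * τ) ^ 2)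
    (v := fun m => K * K * r ^ m.natAbs) hU
    (fun m w hw => (hd hw.1 m).differentiableAt.differentiableWithinAt)
    ((summable_pow_natAbs (Real.exp_pos _).le hr).mul_left _) ?_
  · have hderiv : deriv (fun w => ∑' m : ℤ, cscPi (w - m * τ) ^ 2) z = deriv (Pfun τ) z := by
      refine EventuallyEq.deriv_eq ?_
      filter_upwards [hU] with w hw
      exact (hasSum_Pfun hτ hw.1).tsum_eq
    simpa only [hderiv, (hd hz _).deriv] using h
  · filter_upwards [eventually_norm_cscPi_sub_le (‖z‖ + 1) hτ] with m hm w hw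
    have h1 := hm w τ hw.2 le_rfl
    have hr1 : r ^ m.natAbs ≤ 1 := pow_le_one₀ (Real.exp_pos _).le hr.le
    have hK : 0 ≤ K := by positivity
    rw [norm_pow, sq]
    calc _ ≤ K * r ^ m.natAbs * (K * 1) := by
          gcongr
          exact h1.trans (by gcongr)
      _ = _ := by ring

lemma tendsto_cotPi_add_natCast_mul (z : ℂ) {τ : ℂ} (hτ : 0 < τ.im) :
    Tendsto (fun N : ℕ => cotPi (z + N * τ)) atTop (𝓝 (-(Real.pi * I))) := by
  have hinj : Function.Injective fun N : ℕ => -(N : ℤ) := fun a b h => by simpa using h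
  have h := (summable_norm_cscPi_sub z hτ).tendsto_cofinite_zero.comp hinj.tendsto_cofinite
  rw [Nat.cofinite_eq_atTop] at h
  rw [tendsto_iff_norm_sub_tendsto_zero]
  refine squeeze_zero' (Eventually.of_forall fun _ => norm_nonneg _) ?_ h
  filter_upwards [(tendsto_natCast_atTop_atTop.atTop_mul_const hτ).eventually_gt_atTop (-z.im)]
    with N hN
  have him : 0 < (z + N * τ).im := by
    simp
    linarith
  simpa using norm_cotPi_add_le him

lemma zetafun_sub_self {τ z : ℂ} (hτ : 0 < τ.im) (hz : z ∉ latticeSet τ) :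
    zetafun τ (z - τ) = zetafun τ z + 2 * Real.pi * I := by
  have hz' : z - τ ∉ latticeSet τ := by
    simpa using sub_intCast_mul_notMem_latticeSet hz 1
  have h := (hasSum_zetafun hτ hz').sub (hasSum_zetafun hτ hz)
  have h' : HasSum _ _ (SummationFilter.symmetricIco ℤ) :=
    h.mono_left SummationFilter.LeAtTop.le_atTop
  rw [SummationFilter.hasSum_symmetricIco_int_iff] at h'
  have hsum (N : ℕ) : ∑ m ∈ Finset.Ico (-(N : ℤ)) N, (cotPi (z - τ - m * τ) + cotPi (m * τ) -
      (cotPi (z - m * τ) + cotPi (m * τ))) = -cotPi (-z + N * τ) - cotPi (z + N * τ) := by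
    rw [← neg_inj, ← Finset.sum_neg_distrib]
    convert Finset.sum_Ico_int_sub N fun m : ℤ => cotPi (z - m * τ) using 1
    · refine Finset.sum_congr rfl fun m _ => ?_
      rw [sub_sub z, ← one_add_mul, Int.cast_add, Int.cast_one, add_comm 1 (m : ℂ)]
      ring
    · rw [← cotPi_neg]
      push_cast
      ring_nf
  simp only [hsum] at h'
  have hlim := (tendsto_cotPi_add_natCast_mul (-z) hτ).neg.sub (tendsto_cotPi_add_natCast_mul z hτ)
  linear_combination tendsto_nhds_unique h' hlim

lemma zetafun_sub_intCast_mul {τ z : ℂ} (hτ : 0 < τ.im) (hz : z ∉ latticeSet τ) (n : ℤ) :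
    zetafun τ (z - n * τ) = zetafun τ z + 2 * Real.pi * I * n := by
  induction n using Int.induction_on with
  | zero => simp
  | succ n ih =>
    have h := zetafun_sub_self hτ (sub_intCast_mul_notMem_latticeSet hz n)
    push_cast at h ih ⊢
    rw [add_mul, one_mul, ← sub_sub, h, ih]
    ring
  | pred n ih =>
    have h := zetafun_sub_self hτ (sub_intCast_mul_notMem_latticeSet hz (-n - 1))
    have e : z - ((-n - 1 : ℤ) : ℂ) * τ - τ = z - ((-n : ℤ) : ℂ) * τ := by
      push_cast
      ring
    rw [e, ih] at h
    push_cast at h ⊢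
    linear_combination -h

lemma hasSum_cscPi_mul_cscPi_mul_cscPi {τ z : ℂ} (hτ : 0 < τ.im) (hz : z ∉ latticeSet τ) :
    HasSum (fun m : ℤ => cscPi z * cscPi (z - m * τ) * cscPi (m * τ))
      ((zetafun τ z - cotPi z) * cscPi z ^ 2) := by
  have hz' := notMem_latticeSet_iff.mp hz
  refine (((hasSum_zetafun hτ hz).sub (hasSum_ite_eq 0 (cotPi z))).mul_right _).congr_fun
    fun m => ?_
  rcases eq_or_ne m 0 with rfl | hm
  · simp
  · have hz0 : sin (Real.pi * z) ≠ 0 := by simpa using hz' 0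
    have := ofReal_pi_ne_zero
    rw [if_neg hm, sub_zero, cotPi_sub_add_cotPi (hz' m) (sin_pi_mul_intCast_mul_ne_zero hτ hm)]
    simp only [cscPi]
    field_simp

lemma hasSum_zetafun_sub_cotPi_mul_cscPi_sq {τ z : ℂ} (hτ : 0 < τ.im) (hz : z ∉ latticeSet τ) :
    HasSum (fun n : ℤ => (zetafun τ (z - n * τ) - cotPi (z - n * τ)) * cscPi (z - n * τ) ^ 2)
      0 := by
  let g : ℤ × ℤ → ℂ := fun p =>
    cscPi (z - p.1 * τ) * cscPi (z - p.2 * τ) * cscPi ((p.2 - p.1) * τ)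
  have hS := summable_norm_cscPi_sub z hτ
  have hS0 := summable_norm_cscPi_sub 0 hτ
  have hg : Summable g := by
    refine Summable.of_norm_bounded
      ((hS.mul_of_nonneg hS (fun _ => norm_nonneg _) fun _ => norm_nonneg _).mul_right
        (∑' m : ℤ, ‖cscPi (0 - m * τ)‖)) fun p => ?_
    simp only [g, norm_mul]
    gcongr
    have := hS0.le_tsum (p.2 - p.1) fun _ _ => norm_nonneg _
    simpa using this
  have hanti : g ∘ Equiv.prodComm ℤ ℤ = fun p => -g p := by
    ext p
    simp only [g, Function.comp_apply, Equiv.prodComm_apply, Prod.fst_swap, Prod.snd_swap]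
    rw [← neg_sub (p.2 : ℂ), neg_mul, cscPi_neg]
    ring
  have h := hg.hasSum
  have hswap := (Equiv.prodComm ℤ ℤ).hasSum_iff.mpr h
  rw [hanti] at hswap
  rw [self_eq_neg.mp (hswap.unique h.neg)] at h
  refine h.prod_fiberwise fun n => ?_
  have hrow := hasSum_cscPi_mul_cscPi_mul_cscPi hτ (sub_intCast_mul_notMem_latticeSet hz n)
  rw [← (Equiv.subRight n).hasSum_iff] at hrow
  convert hrow using 2 with k
  simp only [g, Function.comp_apply, Equiv.subRight_apply, Int.cast_sub]
  rw [sub_sub z, ← add_mul, add_sub_cancel]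

/-- Heat-type equation for the modified zeta function:
`2πi ∂_τ ζ(z;τ) = −ζ(z;τ) P(z;τ) − (1/2) P′(z;τ)`. -/
theorem modified_zeta_heat_equation
    (τ : ℂ) (hτ : 0 < τ.im) (z : ℂ) (hz : z ∉ latticeSet τ) :
    2 * (Real.pi : ℂ) * Complex.I * deriv (fun s => zetafun s z) τ =
      -(zetafun τ z * Pfun τ z) - (1 / 2) * deriv (Pfun τ) z := by
  have h1 := hasSum_zetafun_sub_cotPi_mul_cscPi_sq hτ hz
  simp only [zetafun_sub_intCast_mul hτ hz] at h1
  have h2 := (((hasSum_Pfun hτ hz).mul_left (zetafun τ z)).add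
    ((hasSum_deriv_zetafun hτ hz).mul_left (2 * Real.pi * I))).add
    ((hasSum_deriv_Pfun hτ hz).mul_left (1 / 2))
  have h3 : _ = (0 : ℂ) := h2.unique (h1.congr_fun fun n => by ring)
  linear_combination h3
end
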